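/- arXiv:2409.10682 — 8 statements merged into one kernel-verified Lean document; each statement's English description precedes it below -/
import Mathlib

section
/- There exists a constant c > 0 such that for all real X ≥ 2, the number of even positive integers n ≤ X that are NOT expressible in the form n = 2·(3abc + 2ab + a + c + 1) for some nonnegative integers a, b, c satisfying abc + 3ab − a − c + 2 ≡ 0 (mod 5) is at most c·X/(log X)^(1/40). -/
namespace DL
open ArithmeticFunction Finset

/-- Indicator of positive integers having no prime factor in the class `r` mod `q`. -/
noncomputable def avoid (q : ℕ) (r : ZMod q) : ArithmeticFunction ℝ := by
  classical
  exact ⟨fun n => if n ≠ 0 ∧ ∀ p : ℕ, p.Prime → p ∣ n → (p : ZMod q) ≠ r then 1 else 0, by simp⟩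

variable {q : ℕ} {r : ZMod q}

open Classical in
lemma avoid_apply (n : ℕ) : avoid q r n =
    if n ≠ 0 ∧ ∀ p : ℕ, p.Prime → p ∣ n → (p : ZMod q) ≠ r then 1 else 0 := rfl

lemma avoid_one : avoid q r 1 = 1 := by
  rw [avoid_apply, if_pos]
  refine ⟨one_ne_zero, fun p hp h => ?_⟩
  exact absurd (Nat.dvd_one.mp h) hp.one_lt.ne'

lemma avoid_nonneg (n : ℕ) : 0 ≤ avoid q r n := by
  rw [avoid_apply]; split_ifs <;> norm_num

lemma avoid_le_one (n : ℕ) : avoid q r n ≤ 1 := by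
  rw [avoid_apply]; split_ifs <;> norm_num

lemma avoid_mul (m n : ℕ) : avoid q r (m * n) = avoid q r m * avoid q r n := by
  simp only [avoid_apply]
  by_cases hm : m ≠ 0 ∧ ∀ p : ℕ, p.Prime → p ∣ m → (p : ZMod q) ≠ r
  · by_cases hn : n ≠ 0 ∧ ∀ p : ℕ, p.Prime → p ∣ n → (p : ZMod q) ≠ r
    · rw [if_pos hm, if_pos hn, if_pos, one_mul]
      refine ⟨mul_ne_zero hm.1 hn.1, fun p hp h => ?_⟩
      rcases (Nat.Prime.dvd_mul hp).mp h with h | h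
      · exact hm.2 p hp h
      · exact hn.2 p hp h
    · rw [if_neg hn, mul_zero, if_neg]
      rintro ⟨h1, h2⟩
      exact hn ⟨right_ne_zero_of_mul h1, fun p hp h => h2 p hp (h.mul_left m)⟩
  · rw [if_neg hm, zero_mul, if_neg]
    rintro ⟨h1, h2⟩
    exact hm ⟨left_ne_zero_of_mul h1, fun p hp h => h2 p hp (h.mul_right n)⟩

/-- The von Mangoldt function restricted to the avoiding set. -/
noncomputable def avL (q : ℕ) (r : ZMod q) : ArithmeticFunction ℝ := (avoid q r).pmul Λ

lemma avL_apply (n : ℕ) : avL q r n = avoid q r n * Λ n := rfl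

lemma avL_nonneg (n : ℕ) : 0 ≤ avL q r n :=
  mul_nonneg (avoid_nonneg n) vonMangoldt_nonneg

lemma avL_le (n : ℕ) : avL q r n ≤ Λ n :=
  mul_le_of_le_one_left vonMangoldt_nonneg (avoid_le_one n)

lemma avoid_mul_avL (n : ℕ) : (avoid q r * avL q r) n = avoid q r n * Real.log n := by
  rw [mul_apply, ← vonMangoldt_sum, mul_sum, Nat.sum_divisorsAntidiagonal'
    (f := fun a b => avoid q r a * avL q r b)]
  refine sum_congr rfl fun d hd => ?_
  rw [avL_apply, ← mul_assoc, ← avoid_mul, Nat.div_mul_cancel (Nat.dvd_of_mem_divisors hd)]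

lemma avL_pointwise (n : ℕ) : avL q r n ≤ Λ n - vonMangoldt.residueClass r n +
    (if n.Prime then 0 else vonMangoldt.residueClass r n) := by
  split_ifs with hp
  · by_cases h : (n : ZMod q) = r
    · have h0 : avoid q r n = 0 := by
        rw [avoid_apply, if_neg]
        rintro ⟨-, h2⟩
        exact h2 n hp dvd_rfl h
      have h1 := vonMangoldt.residueClass_le r n
      rw [avL_apply, h0]; linarith
    · have : vonMangoldt.residueClass r n = 0 := by
        simp [vonMangoldt.residueClass, h]
      rw [this]; linarith [avL_le (q := q) (r := r) n]
  · linarith [avL_le (q := q) (r := r) n]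

/-- Counting bound. -/
lemma count_bound (N : ℕ) (hN : 1 ≤ N) :
    (∑ n ∈ Ioc 0 N, avoid q r n) * Real.log N ≤
      (Real.log 4 + 5) * N * ∑ n ∈ Ioc 0 N, avoid q r n / n := by
  have hNp : (0 : ℝ) < N := by exact_mod_cast hN
  have h1 : ∑ n ∈ Ioc 0 N, avoid q r n * Real.log n ≤
      (Real.log 4 + 4) * N * ∑ n ∈ Ioc 0 N, avoid q r n / n := by
    calc ∑ n ∈ Ioc 0 N, avoid q r n * Real.log n
        = ∑ n ∈ Ioc 0 N, (avoid q r * avL q r) n :=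
          sum_congr rfl fun n _ => (avoid_mul_avL n).symm
      _ = ∑ n ∈ Ioc 0 N, avoid q r n * ∑ m ∈ Ioc 0 (N / n), avL q r m :=
          sum_Ioc_mul_eq_sum_sum _ _ _
      _ ≤ ∑ n ∈ Ioc 0 N, avoid q r n * ((Real.log 4 + 4) * (N / n : ℝ)) := by
          refine sum_le_sum fun n hn => mul_le_mul_of_nonneg_left ?_ (avoid_nonneg n)
          calc ∑ m ∈ Ioc 0 (N / n), avL q r m ≤ ∑ m ∈ Ioc 0 (N / n), Λ m :=
                sum_le_sum fun m _ => avL_le m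
            _ = Chebyshev.psi (N / n : ℝ) := by
                rw [Chebyshev.psi, Nat.floor_div_eq_div]
            _ ≤ _ := Chebyshev.psi_le_const_mul_self (by positivity)
      _ = _ := by
          rw [mul_sum]
          refine sum_congr rfl fun n _ => by ring
  have h2 : ∑ n ∈ Ioc 0 N, avoid q r n * (Real.log N - Real.log n) ≤
      N * ∑ n ∈ Ioc 0 N, avoid q r n / n := by
    rw [mul_sum]
    refine sum_le_sum fun n hn => ?_
    have hn0 : (0 : ℝ) < n := by exact_mod_cast (mem_Ioc.mp hn).1
    rw [← Real.log_div hNp.ne' hn0.ne']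
    calc avoid q r n * Real.log (N / n) ≤ avoid q r n * (N / n) :=
          mul_le_mul_of_nonneg_left (Real.log_le_self (by positivity)) (avoid_nonneg n)
      _ = _ := by ring
  have h3 : (∑ n ∈ Ioc 0 N, avoid q r n) * Real.log N =
      ∑ n ∈ Ioc 0 N, avoid q r n * Real.log n +
      ∑ n ∈ Ioc 0 N, avoid q r n * (Real.log N - Real.log n) := by
    rw [sum_mul, ← sum_add_distrib]
    exact sum_congr rfl fun n _ => by ring
  rw [h3]; linarith

lemma LSeries_ofReal (f : ℕ → ℝ) (hf : f 0 = 0) (x : ℝ) :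
    LSeries (fun n => (f n : ℂ)) (x : ℂ) = ((∑' n, f n / (n : ℝ) ^ x : ℝ) : ℂ) := by
  rw [Complex.ofReal_tsum, LSeries]
  refine tsum_congr fun n => ?_
  rcases eq_or_ne n 0 with rfl | hn
  · simp [hf]
  · rw [LSeries.term_of_ne_zero hn, Complex.ofReal_div, Complex.ofReal_cpow (Nat.cast_nonneg _),
      Complex.ofReal_natCast]

lemma vonMangoldt_upper : ∃ C : ℝ, ∀ x : ℝ, x ∈ Set.Ioc 1 2 →
    ∑' n, Λ n / (n : ℝ) ^ x ≤ 1 / (x - 1) + C := by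
  have ha : IsUnit (1 : ZMod 1) := isUnit_one
  have H {x : ℝ} (hx : 1 < x) :
      ∑' n, Λ n / (n : ℝ) ^ x =
        (vonMangoldt.LFunctionResidueClassAux (1 : ZMod 1) x).re + 1 / (x - 1) := by
    refine Complex.ofReal_injective ?_
    have h1 := vonMangoldt.eqOn_LFunctionResidueClassAux ha
      (Set.mem_ofPred.mpr ((Complex.ofReal_re x).symm ▸ hx))
    have h2 := vonMangoldt.LFunctionResidueClassAux_real ha hx
    have h3 : (fun n : ℕ => ((vonMangoldt.residueClass (1 : ZMod 1) n : ℝ) : ℂ)) =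
        fun n => ((Λ n : ℝ) : ℂ) := by
      ext n
      rw [vonMangoldt.residueClass, Set.indicator_of_mem]
      exact Subsingleton.elim (α := ZMod 1) _ _
    rw [Complex.ofReal_add, ← h2, h1, ← LSeries_ofReal (fun n => Λ n) (by simp)]
    simp only [h3]
    simp
  have : ContinuousOn (fun x : ℝ ↦ (vonMangoldt.LFunctionResidueClassAux (1 : ZMod 1) x).re)
      (Set.Icc 1 2) :=
    Complex.continuous_re.continuousOn.comp (t := Set.univ)
      (vonMangoldt.continuousOn_LFunctionResidueClassAux (1 : ZMod 1))
      (fun ⦃x⦄ a ↦ trivial) |>.comp Complex.continuous_ofReal.continuousOn fun x hx ↦ by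
        simpa only [Set.mem_ofPred_eq, Complex.ofReal_re] using hx.1
  obtain ⟨C, hC⟩ := bddAbove_def.mp <| IsCompact.bddAbove_image isCompact_Icc this
  refine ⟨C, fun x hx => ?_⟩
  rw [H hx.1]
  have := hC _ (Set.mem_image_of_mem _ (Set.mem_Icc_of_Ioc hx))
  linarith

lemma summable_Lam {x : ℝ} (hx : 1 < x) : Summable fun n : ℕ => Λ n / (n : ℝ) ^ x := by
  have h1 : (1 : EReal) < x := by exact_mod_cast hx
  refine LSeries.summable_real_of_abscissaOfAbsConv_lt (lt_of_le_of_lt ?_ h1 :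
    LSeries.abscissaOfAbsConv (fun n => ((Λ n : ℝ) : ℂ)) < x)
  refine LSeries.abscissaOfAbsConv_le_of_forall_lt_LSeriesSummable fun y hy ↦ ?_
  exact LSeriesSummable_vonMangoldt (by simpa using hy)

lemma absc_avoid : LSeries.abscissaOfAbsConv (fun n => ((avoid q r n : ℝ) : ℂ)) ≤ 1 := by
  refine LSeries.abscissaOfAbsConv_le_of_le_const ⟨1, fun n _ => ?_⟩
  rw [Complex.norm_real, Real.norm_of_nonneg (avoid_nonneg n)]
  exact avoid_le_one n

lemma absc_avL : LSeries.abscissaOfAbsConv (fun n => ((avL q r n : ℝ) : ℂ)) ≤ 1 := by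
  refine LSeries.abscissaOfAbsConv_le_of_forall_lt_LSeriesSummable fun y hy ↦ ?_
  have h := LSeriesSummable_vonMangoldt (s := y) (by simpa using hy)
  refine Summable.of_norm_bounded (Summable.norm h) fun n => LSeries.norm_term_le _ ?_
  rw [Complex.norm_real, Complex.norm_real, Real.norm_of_nonneg (avL_nonneg n),
    Real.norm_of_nonneg vonMangoldt_nonneg]
  exact avL_le n

/-- The Dirichlet series of `avoid`. -/
noncomputable def G (q : ℕ) (r : ZMod q) (x : ℝ) : ℝ := ∑' n, avoid q r n / (n : ℝ) ^ x

/-- The Dirichlet series of `avL`. -/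
noncomputable def GV (q : ℕ) (r : ZMod q) (x : ℝ) : ℝ := ∑' n, avL q r n / (n : ℝ) ^ x

lemma summable_avoid {x : ℝ} (hx : 1 < x) : Summable fun n : ℕ => avoid q r n / (n : ℝ) ^ x :=
  LSeries.summable_real_of_abscissaOfAbsConv_lt
    (lt_of_le_of_lt absc_avoid (by exact_mod_cast hx))

lemma summable_avL {x : ℝ} (hx : 1 < x) : Summable fun n : ℕ => avL q r n / (n : ℝ) ^ x :=
  LSeries.summable_real_of_abscissaOfAbsConv_lt
    (lt_of_le_of_lt absc_avL (by exact_mod_cast hx))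

lemma G_hasDerivAt {x : ℝ} (hx : 1 < x) : HasDerivAt (G q r) (-(G q r x * GV q r x)) x := by
  have h1 := LSeries_hasDerivAt (f := fun n => ((avoid q r n : ℝ) : ℂ)) (s := (x : ℂ))
    (lt_of_le_of_lt absc_avoid (by simpa using (by exact_mod_cast hx : (1 : EReal) < x)))
  have h2 := h1.real_of_complex
  have h3 : LSeries (LSeries.logMul fun n => ((avoid q r n : ℝ) : ℂ)) x =
      ((G q r x * GV q r x : ℝ) : ℂ) := by
    have hc : LSeries.logMul (fun n => ((avoid q r n : ℝ) : ℂ)) =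
        LSeries.convolution (fun n => ((avoid q r n : ℝ) : ℂ))
          (fun n => ((avL q r n : ℝ) : ℂ)) := by
      rw [LSeries.convolution_def]
      ext n
      have := avoid_mul_avL (q := q) (r := r) n
      rw [mul_apply] at this
      rw [LSeries.logMul, ← Complex.natCast_log, mul_comm, ← Complex.ofReal_mul, ← this]
      push_cast
      rfl
    rw [hc, LSeries_convolution (lt_of_le_of_lt absc_avoid (by simpa using (by exact_mod_cast hx : (1 : EReal) < x)))
      (lt_of_le_of_lt absc_avL (by simpa using (by exact_mod_cast hx : (1 : EReal) < x))),
      LSeries_ofReal _ (by simp), LSeries_ofReal _ (by simp), G, GV, Complex.ofReal_mul]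
  rw [h3, Complex.neg_re, Complex.ofReal_re] at h2
  refine h2.congr_of_eventuallyEq (Filter.Eventually.of_forall fun y => ?_)
  simp only
  rw [LSeries_ofReal _ (by simp), Complex.ofReal_re, G]

lemma GV_upper [NeZero q] (hr : IsUnit r) : ∃ C : ℝ, ∀ x : ℝ, x ∈ Set.Ioc 1 2 →
    GV q r x ≤ (1 - (q.totient : ℝ)⁻¹) / (x - 1) + C := by
  obtain ⟨C1, h1⟩ := vonMangoldt_upper
  obtain ⟨C2, h2⟩ := vonMangoldt.LSeries_residueClass_lower_bound hr
  refine ⟨C1 + C2 + ∑' n : ℕ, (if n.Prime then 0 else vonMangoldt.residueClass r n) / (n : ℝ),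
    fun x hx => ?_⟩
  have hs1 := summable_Lam hx.1
  have hs2 : Summable fun n : ℕ => vonMangoldt.residueClass r n / (n : ℝ) ^ x :=
    LSeries.summable_real_of_abscissaOfAbsConv_lt <|
        (vonMangoldt.abscissaOfAbsConv_residueClass_le_one r).trans_lt <| mod_cast hx.1
  have hs3 := vonMangoldt.summable_residueClass_non_primes_div r
  have hle : GV q r x ≤ ∑' n : ℕ, (Λ n / (n : ℝ) ^ x - vonMangoldt.residueClass r n / (n : ℝ) ^ x
      + (if n.Prime then 0 else vonMangoldt.residueClass r n) / (n : ℝ)) := by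
    refine Summable.tsum_le_tsum (fun n => ?_) (summable_avL hx.1) ((hs1.sub hs2).add hs3)
    rcases n.eq_zero_or_pos with rfl | hn
    · simp
    · have hn1 : (1 : ℝ) ≤ n := by exact_mod_cast hn
      have hpow : (n : ℝ) ≤ (n : ℝ) ^ x := by
        conv_lhs => rw [← Real.rpow_one n]
        exact Real.rpow_le_rpow_of_exponent_le hn1 hx.1.le
      have h0 : (0 : ℝ) ≤ if n.Prime then 0 else vonMangoldt.residueClass r n := by
        split_ifs
        · exact le_rfl
        · exact vonMangoldt.residueClass_nonneg r n
      calc avL q r n / (n : ℝ) ^ x ≤ (Λ n - vonMangoldt.residueClass r n +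
            (if n.Prime then 0 else vonMangoldt.residueClass r n)) / (n : ℝ) ^ x :=
            div_le_div_of_nonneg_right (avL_pointwise n) (by positivity)
        _ = Λ n / (n : ℝ) ^ x - vonMangoldt.residueClass r n / (n : ℝ) ^ x +
            (if n.Prime then 0 else vonMangoldt.residueClass r n) / (n : ℝ) ^ x := by ring
        _ ≤ _ := by
            gcongr
  rw [(hs1.sub hs2).tsum_add hs3, hs1.tsum_sub hs2] at hle
  have e : (1 - (q.totient : ℝ)⁻¹) / (x - 1) = 1 / (x - 1) - (q.totient : ℝ)⁻¹ / (x - 1) := by ring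
  have := h1 x hx
  have := h2 hx
  rw [e]
  linarith

lemma G_ge_one {x : ℝ} (hx : 1 < x) : 1 ≤ G q r x := by
  have h := (summable_avoid (q := q) (r := r) hx).le_tsum 1
    (fun n _ => div_nonneg (avoid_nonneg n) (by positivity))
  simpa [avoid_one, G] using h

lemma G_upper [NeZero q] (hr : IsUnit r) : ∃ K : ℝ, 0 < K ∧ ∀ x : ℝ, x ∈ Set.Ioc 1 2 →
    G q r x ≤ K * (1 / (x - 1)) ^ (1 - (q.totient : ℝ)⁻¹) := by
  obtain ⟨C, hC⟩ := GV_upper (q := q) hr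
  set δ := (q.totient : ℝ)⁻¹
  let h : ℝ → ℝ := fun x => Real.log (G q r x) + (1 - δ) * Real.log (x - 1) + C * x
  have hd : ∀ x : ℝ, 1 < x → HasDerivAt h (-GV q r x + (1 - δ) / (x - 1) + C) x := by
    intro x hx
    have hG := G_ge_one (q := q) (r := r) hx
    have d1 := (G_hasDerivAt (q := q) (r := r) hx).log (by linarith)
    have d2 := (((hasDerivAt_id x).sub_const 1).log (by simp; linarith)).const_mul (1 - δ)
    have d3 := (hasDerivAt_id x).const_mul C
    have hG0 : G q r x ≠ 0 := by linarith
    have e : -GV q r x + (1 - δ) / (x - 1) + C =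
        -(G q r x * GV q r x) / G q r x + (1 - δ) * (1 / (id x - 1)) + C * 1 := by
      rw [neg_div, mul_div_cancel_left₀ _ hG0, mul_one_div, mul_one, id]
    rw [e]
    exact (d1.add d2).add d3
  have hm : MonotoneOn h (Set.Ioc 1 2) := by
    refine monotoneOn_of_deriv_nonneg (convex_Ioc 1 2)
      (fun x hx => (hd x hx.1).continuousAt.continuousWithinAt) ?_ ?_
    · intro x hx
      rw [interior_Ioc] at hx
      exact (hd x hx.1).differentiableAt.differentiableWithinAt
    · intro x hx
      rw [interior_Ioc] at hx
      rw [(hd x hx.1).deriv]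
      linarith [hC x ⟨hx.1, hx.2.le⟩]
  refine ⟨Real.exp (h 2 + |C| * 2), Real.exp_pos _, fun x hx => ?_⟩
  have h1 := hm hx ⟨one_lt_two, le_rfl⟩ hx.2
  have hx1 : 0 < x - 1 := by linarith [hx.1]
  have hG := G_ge_one (q := q) (r := r) hx.1
  have h2 : -(C * x) ≤ |C| * 2 := by
    calc -(C * x) ≤ |C * x| := neg_le_abs _
      _ = |C| * |x| := abs_mul _ _
      _ ≤ |C| * 2 := by
        gcongr
        rw [abs_of_pos (by linarith)]; exact hx.2
  rw [Real.rpow_def_of_pos (by positivity), ← Real.exp_add, ← Real.log_le_iff_le_exp (by linarith),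
    one_div, Real.log_inv]
  simp only [h] at h1 ⊢
  linarith

/-- Final counting bound for the avoiding set. -/
lemma count_final [NeZero q] (hr : IsUnit r) : ∃ K : ℝ, 0 < K ∧ ∀ N : ℕ, 3 ≤ N →
    ∑ n ∈ Ioc 0 N, avoid q r n ≤ K * N / (Real.log N) ^ ((q.totient : ℝ)⁻¹) := by
  obtain ⟨K, hK, hG⟩ := G_upper (q := q) hr
  have hl4 : 0 < Real.log 4 := Real.log_pos (by norm_num)
  refine ⟨(Real.log 4 + 5) * Real.exp 1 * K, by positivity, fun N hN => ?_⟩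
  have hN3 : (3 : ℝ) ≤ N := by exact_mod_cast hN
  have hN0 : (0 : ℝ) < N := by linarith
  have hl : 1 ≤ Real.log N := by
    rw [Real.le_log_iff_exp_le hN0]
    linarith [Real.exp_one_lt_d9]
  set ℓ := Real.log N with hℓ
  have hℓ0 : 0 < ℓ := by linarith
  have hx : 1 + 1 / ℓ ∈ Set.Ioc (1 : ℝ) 2 := by
    constructor
    · have : 0 < 1 / ℓ := by positivity
      linarith
    · have : 1 / ℓ ≤ 1 := by rw [div_le_one hℓ0]; exact hl
      linarith
  have h1 : ∑ n ∈ Ioc 0 N, avoid q r n / n ≤ Real.exp 1 * G q r (1 + 1 / ℓ) := by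
    calc ∑ n ∈ Ioc 0 N, avoid q r n / n
        ≤ ∑ n ∈ Ioc 0 N, Real.exp 1 * (avoid q r n / (n : ℝ) ^ (1 + 1 / ℓ)) := by
          refine sum_le_sum fun n hn => ?_
          have hn0 : (0 : ℝ) < n := by exact_mod_cast (mem_Ioc.mp hn).1
          have hnN : (n : ℝ) ≤ N := by exact_mod_cast (mem_Ioc.mp hn).2
          have hpow : (n : ℝ) ^ (1 / ℓ) ≤ Real.exp 1 := by
            rw [Real.rpow_def_of_pos hn0]
            refine Real.exp_le_exp.mpr ?_
            rw [mul_one_div, div_le_one hℓ0]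
            exact Real.log_le_log hn0 hnN
          rw [Real.rpow_add hn0, Real.rpow_one, ← mul_div_assoc,
            div_le_div_iff₀ hn0 (by positivity)]
          calc avoid q r n * ((n : ℝ) * (n : ℝ) ^ (1 / ℓ))
              ≤ avoid q r n * ((n : ℝ) * Real.exp 1) := by
                have := avoid_nonneg (q := q) (r := r) n
                gcongr
            _ = _ := by ring
      _ = Real.exp 1 * ∑ n ∈ Ioc 0 N, (avoid q r n / (n : ℝ) ^ (1 + 1 / ℓ)) := by rw [mul_sum]
      _ ≤ _ := by
          refine mul_le_mul_of_nonneg_left ?_ (Real.exp_pos 1).le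
          exact (summable_avoid hx.1).sum_le_tsum _
            (fun n _ => div_nonneg (avoid_nonneg n) (by positivity))
  have h2 := hG _ hx
  rw [show 1 / (1 + 1 / ℓ - 1) = ℓ by field_simp; simp, Real.rpow_sub hℓ0, Real.rpow_one] at h2
  have h3 := count_bound (q := q) (r := r) N (by omega)
  rw [← hℓ] at h3
  refine le_of_mul_le_mul_right ?_ hℓ0
  calc _ ≤ _ := h3
    _ ≤ (Real.log 4 + 5) * N * (Real.exp 1 * (K * (ℓ / ℓ ^ ((q.totient : ℝ)⁻¹)))) := by
        gcongr
        exact h1.trans (mul_le_mul_of_nonneg_left h2 (Real.exp_pos 1).le)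
    _ = _ := by ring

/-- Uniform version with exponent `1/40`, in terms of cardinalities. -/
lemma count_X [NeZero q] (hr : IsUnit r) (hq : q.totient ≤ 40) :
    ∃ K : ℝ, 0 < K ∧ ∀ X : ℝ, 2 ≤ X →
    ({n : ℕ | 0 < n ∧ (n : ℝ) ≤ 2 * X ∧
      ∀ p : ℕ, p.Prime → p ∣ n → (p : ZMod q) ≠ r}.ncard : ℝ) ≤
      K * X / (Real.log X) ^ ((1 : ℝ) / 40) := by
  obtain ⟨K, hK, h⟩ := count_final (q := q) hr
  refine ⟨2 * K, by positivity, fun X hX => ?_⟩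
  set N := ⌊2 * X⌋₊ with hN
  have hN1 : (N : ℝ) ≤ 2 * X := Nat.floor_le (by linarith)
  have hN2 : 2 * X < N + 1 := Nat.lt_floor_add_one _
  have hN3 : 3 ≤ N := Nat.le_floor (by push_cast; linarith)
  have hN3' : (3 : ℝ) ≤ N := by exact_mod_cast hN3
  have hl : 1 ≤ Real.log N := by
    rw [Real.le_log_iff_exp_le (by linarith)]
    linarith [Real.exp_one_lt_d9]
  have hX0 : 0 < Real.log X := Real.log_pos (by linarith)
  have hXN : Real.log X ≤ Real.log N := Real.log_le_log (by linarith) (by linarith)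
  have hcard : ({n : ℕ | 0 < n ∧ (n : ℝ) ≤ 2 * X ∧
      ∀ p : ℕ, p.Prime → p ∣ n → (p : ZMod q) ≠ r}.ncard : ℝ) ≤
      ∑ n ∈ Ioc 0 N, avoid q r n := by
    classical
    have e : {n : ℕ | 0 < n ∧ (n : ℝ) ≤ 2 * X ∧
      ∀ p : ℕ, p.Prime → p ∣ n → (p : ZMod q) ≠ r} =
      ↑((Ioc 0 N).filter fun n => n ≠ 0 ∧ ∀ p : ℕ, p.Prime → p ∣ n → (p : ZMod q) ≠ r) := by
      ext n
      simp only [Set.mem_ofPred_eq, coe_filter, mem_Ioc, hN]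
      constructor
      · rintro ⟨h1, h2, h3⟩
        exact ⟨⟨h1, Nat.le_floor h2⟩, h1.ne', h3⟩
      · rintro ⟨⟨h1, h2⟩, -, h3⟩
        exact ⟨h1, (Nat.le_floor_iff (by linarith)).mp h2, h3⟩
    rw [e, Set.ncard_coe_finset, card_filter]
    push_cast
    refine sum_le_sum fun n _ => ?_
    rw [avoid_apply]
  have hpow : (Real.log X) ^ ((1 : ℝ) / 40) ≤ (Real.log N) ^ ((q.totient : ℝ)⁻¹) := by
    have htp : (0 : ℝ) < q.totient := by exact_mod_cast q.totient.pos_of_neZero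
    calc (Real.log X) ^ ((1 : ℝ) / 40) ≤ (Real.log N) ^ ((1 : ℝ) / 40) :=
          Real.rpow_le_rpow hX0.le hXN (by norm_num)
      _ ≤ _ := by
          refine Real.rpow_le_rpow_of_exponent_le hl ?_
          rw [one_div]
          refine inv_anti₀ htp (by exact_mod_cast hq)
  have hp0 : 0 < (Real.log X) ^ ((1 : ℝ) / 40) := Real.rpow_pos_of_pos hX0 _
  calc _ ≤ _ := hcard
    _ ≤ _ := h N hN3
    _ ≤ K * (2 * X) / (Real.log X) ^ ((1 : ℝ) / 40) := by gcongr
    _ = _ := by ring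

/-- The representability predicate for `m = n / 2`. -/
def Rep (m : ℕ) : Prop := ∃ a b k : ℕ,
  ((a : ℤ) * b * k + 3 * a * b - a - k + 2) % 5 = 0 ∧
    m = 3 * a * b * k + 2 * a * b + a + k + 1

lemma cast_ne_of {q r p : ℕ} (h : p % q = r % q) : (p : ZMod q) = (r : ZMod q) :=
  (ZMod.natCast_eq_natCast_iff _ _ _).mpr h

lemma rep_three {m : ℕ} (h : m % 5 = 3) : Rep m := by
  refine ⟨0, 0, m - 1, ?_, ?_⟩
  · push_cast [show 1 ≤ m by omega]
    ring_nf
    omega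
  · omega

/-- Case `k = 1`. -/
lemma rep_25 {m p : ℕ} (hm : 2 < m) (hp : p ∣ m - 2)
    (h : (m % 5 = 4 ∧ p % 25 = 11) ∨ (m % 5 = 0 ∧ p % 25 = 6) ∨ (m % 5 = 1 ∧ p % 25 = 16)) :
    Rep m := by
  obtain ⟨a, ha⟩ := hp
  obtain ⟨b, rfl⟩ : ∃ b, p = 5 * b + 1 := ⟨p / 5, by omega⟩
  have hb : (m % 5 = 4 ∧ b % 5 = 2) ∨ (m % 5 = 0 ∧ b % 5 = 1) ∨ (m % 5 = 1 ∧ b % 5 = 3) := by omega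
  have e : m = 5 * (a * b) + a + 2 := by
    have : m = (5 * b + 1) * a + 2 := by omega
    rw [this]; ring
  refine ⟨a, b, 1, ?_, by rw [e]; ring⟩
  have key : (a * b) % 5 = ((a % 5) * (b % 5)) % 5 := Nat.mul_mod a b 5
  have e2 : ((a : ℤ) * b * (1 : ℕ) + 3 * a * b - a - (1 : ℕ) + 2) =
      4 * ((a * b : ℕ) : ℤ) - a + 1 := by push_cast; ring
  rw [e2]
  generalize hab : a * b = t at *
  rcases hb with ⟨h1, h2⟩ | ⟨h1, h2⟩ | ⟨h1, h2⟩
  · have : a % 5 = 2 := by omega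
    rw [this, h2] at key; omega
  · have : a % 5 = 3 := by omega
    rw [this, h2] at key; omega
  · have : a % 5 = 4 := by omega
    rw [this, h2] at key; omega

/-- Case `a = 1`. -/
lemma rep_15 {m p : ℕ} (hm : 2 ≤ m) (hm2 : m % 5 = 2) (hp : p ∣ 3 * m - 4) (h : p % 15 = 7) :
    Rep m := by
  obtain ⟨v, hv⟩ := hp
  have key : (3 * m - 4) % 15 = ((p % 15) * (v % 15)) % 15 := by rw [hv, Nat.mul_mod]
  rw [h] at key
  have hv15 : v % 15 = 11 := by omega
  obtain ⟨b, rfl⟩ : ∃ b, p = 3 * b + 1 := ⟨p / 3, by omega⟩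
  obtain ⟨c, rfl⟩ : ∃ c, v = 3 * c + 2 := ⟨v / 3, by omega⟩
  have hb : b % 5 = 2 := by omega
  have hc : c % 5 = 3 := by omega
  have e : (3 * b + 1) * (3 * c + 2) = 9 * (b * c) + 6 * b + 3 * c + 2 := by ring
  rw [e] at hv
  have key2 : (b * c) % 5 = ((b % 5) * (c % 5)) % 5 := Nat.mul_mod b c 5
  rw [hb, hc] at key2
  refine ⟨1, b, c, ?_, ?_⟩
  · have e2 : (((1 : ℕ) : ℤ) * b * c + 3 * (1 : ℕ) * b - (1 : ℕ) - c + 2) =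
      ((b * c : ℕ) : ℤ) + 3 * b - c + 1 := by push_cast; ring
    rw [e2]
    generalize b * c = t at *
    omega
  · rw [show 3 * 1 * b * c = 3 * (b * c) by ring]
    omega

/-- The set of integers up to `2X` without a prime factor in class `r` mod `q`. -/
def S (q : ℕ) (r : ℕ) (X : ℝ) : Set ℕ := {n : ℕ | 0 < n ∧ (n : ℝ) ≤ 2 * X ∧
      ∀ p : ℕ, p.Prime → p ∣ n → (p : ZMod q) ≠ (r : ZMod q)}

lemma S_finite (q r : ℕ) (X : ℝ) : (S q r X).Finite := by
  refine (Set.finite_Iic ⌊2 * X⌋₊).subset fun n hn => ?_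
  exact Nat.le_floor hn.2.1

lemma S_preimage (q r : ℕ) (X : ℝ) (g : ℕ → ℕ) :
    (Set.image g (S q r X)).ncard ≤ (S q r X).ncard := Set.ncard_image_le (S_finite q r X)

lemma bad_subset (X : ℝ) :
    {n : ℕ | 0 < n ∧ Even n ∧ (n : ℝ) ≤ X ∧
          ¬∃ a b k : ℕ,
            ((a : ℤ) * b * k + 3 * a * b - a - k + 2) % 5 = 0 ∧
            n = 2 * (3 * a * b * k + 2 * a * b + a + k + 1)} ⊆
    ({2, 4} : Set ℕ) ∪ (Set.image (fun t => 2 * (t + 2)) (S 25 11 X)) ∪ (Set.image (fun t => 2 * (t + 2)) (S 25 6 X))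
      ∪ (Set.image (fun t => 2 * (t + 2)) (S 25 16 X)) ∪ (Set.image (fun t => 2 * ((t + 4) / 3)) (S 15 7 X)) := by
  rintro n ⟨hn0, hne, hnX, hbad⟩
  obtain ⟨m, hm⟩ := hne
  have hnm : n = 2 * m := by omega
  have hrep : ¬ Rep m := by
    rintro ⟨a, b, k, h1, h2⟩
    exact hbad ⟨a, b, k, h1, by rw [hnm, h2]⟩
  subst hnm
  have hmX : 2 * (m : ℝ) ≤ X := by push_cast at hnX; exact hnX
  have hm0 : (0 : ℝ) ≤ m := Nat.cast_nonneg m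
  by_cases hm2 : m ≤ 2
  · left; left; left; left
    have : m = 1 ∨ m = 2 := by omega
    rcases this with rfl | rfl <;> simp
  push Not at hm2
  have h25 : ∀ r : ℕ, ((m % 5 = 4 ∧ r = 11) ∨ (m % 5 = 0 ∧ r = 6) ∨ (m % 5 = 1 ∧ r = 16)) →
      2 * m ∈ Set.image (fun t => 2 * (t + 2)) (S 25 r X) := by
    intro r hr
    refine ⟨m - 2, ⟨by omega, ?_, fun p hp hpd hpr => ?_⟩, by simp only; omega⟩
    · have : ((m - 2 : ℕ) : ℝ) ≤ m := by exact_mod_cast Nat.sub_le m 2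
      linarith
    · have := (ZMod.natCast_eq_natCast_iff _ _ _).mp hpr
      unfold Nat.ModEq at this
      exact hrep (rep_25 hm2 hpd (by omega))
  have hcases : m % 5 = 0 ∨ m % 5 = 1 ∨ m % 5 = 2 ∨ m % 5 = 3 ∨ m % 5 = 4 := by omega
  rcases hcases with h | h | h | h | h
  · left; left; right; exact h25 6 (by omega)
  · left; right; exact h25 16 (by omega)
  · right
    refine ⟨3 * m - 4, ⟨by omega, ?_, fun p hp hpd hpr => ?_⟩, by simp only; omega⟩
    · have : ((3 * m - 4 : ℕ) : ℝ) ≤ 3 * m := by exact_mod_cast Nat.sub_le (3 * m) 4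
      linarith
    · have := (ZMod.natCast_eq_natCast_iff _ _ _).mp hpr
      unfold Nat.ModEq at this
      exact hrep (rep_15 hm2.le h hpd (by omega))
  · exact absurd (rep_three h) hrep
  · left; left; left; right; exact h25 11 (by omega)

lemma S_bound (q r : ℕ) [NeZero q] (hr : r.Coprime q) (hq : q.totient ≤ 40) :
    ∃ K : ℝ, 0 < K ∧ ∀ X : ℝ, 2 ≤ X →
    ((S q r X).ncard : ℝ) ≤ K * X / (Real.log X) ^ ((1 : ℝ) / 40) :=
  count_X ((ZMod.isUnit_iff_coprime r q).mpr hr) hq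

end DL

/-- Density-one version of the Davis–Lelievre conjecture: the number of even
positive integers `n ≤ X` not of the form `2·(3abc + 2ab + a + c + 1)` with
`a, b, c ≥ 0` and `abc + 3ab − a − c + 2 ≡ 0 (mod 5)` is `≤ c·X/(log X)^(1/40)`. -/
theorem davis_lelievre_density_one :
    ∃ c : ℝ, 0 < c ∧ ∀ X : ℝ, 2 ≤ X →
      ({n : ℕ | 0 < n ∧ Even n ∧ (n : ℝ) ≤ X ∧
          ¬∃ a b k : ℕ,
            ((a : ℤ) * b * k + 3 * a * b - a - k + 2) % 5 = 0 ∧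
            n = 2 * (3 * a * b * k + 2 * a * b + a + k + 1)}.ncard : ℝ)
        ≤ c * X / Real.log X ^ ((1 : ℝ) / 40) := by
  obtain ⟨K1, hK1, h1⟩ := DL.S_bound 25 11 (by decide) (by decide)
  obtain ⟨K2, hK2, h2⟩ := DL.S_bound 25 6 (by decide) (by decide)
  obtain ⟨K3, hK3, h3⟩ := DL.S_bound 25 16 (by decide) (by decide)
  obtain ⟨K4, hK4, h4⟩ := DL.S_bound 15 7 (by decide) (by decide)
  refine ⟨2 + K1 + K2 + K3 + K4, by positivity, fun X hX => ?_⟩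
  have hl0 : 0 < Real.log X := Real.log_pos (by linarith)
  have hp0 : 0 < Real.log X ^ ((1 : ℝ) / 40) := Real.rpow_pos_of_pos hl0 _
  have hone : 1 ≤ X / Real.log X ^ ((1 : ℝ) / 40) := by
    rw [one_le_div hp0]
    calc Real.log X ^ ((1 : ℝ) / 40) ≤ X ^ ((1 : ℝ) / 40) :=
          Real.rpow_le_rpow hl0.le (Real.log_le_self (by linarith)) (by norm_num)
      _ ≤ X ^ (1 : ℝ) := Real.rpow_le_rpow_of_exponent_le (by linarith) (by norm_num)
      _ = X := Real.rpow_one X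
  have hfin := ((((Set.toFinite ({2, 4} : Set ℕ)).union
    ((DL.S_finite 25 11 X).image (fun t => 2 * (t + 2)))).union
    ((DL.S_finite 25 6 X).image (fun t => 2 * (t + 2)))).union
    ((DL.S_finite 25 16 X).image (fun t => 2 * (t + 2)))).union
    ((DL.S_finite 15 7 X).image (fun t => 2 * ((t + 4) / 3)))
  have hc := Set.ncard_le_ncard (DL.bad_subset X) hfin
  have hu : (({2, 4} : Set ℕ) ∪ (Set.image (fun t => 2 * (t + 2)) (DL.S 25 11 X)) ∪
      (Set.image (fun t => 2 * (t + 2)) (DL.S 25 6 X)) ∪ (Set.image (fun t => 2 * (t + 2)) (DL.S 25 16 X)) ∪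
      (Set.image (fun t => 2 * ((t + 4) / 3)) (DL.S 15 7 X))).ncard ≤
      2 + (DL.S 25 11 X).ncard + (DL.S 25 6 X).ncard + (DL.S 25 16 X).ncard +
        (DL.S 15 7 X).ncard := by
    refine (Set.ncard_union_le _ _).trans (add_le_add ?_ (DL.S_preimage _ _ _ _))
    refine (Set.ncard_union_le _ _).trans (add_le_add ?_ (DL.S_preimage _ _ _ _))
    refine (Set.ncard_union_le _ _).trans (add_le_add ?_ (DL.S_preimage _ _ _ _))
    refine (Set.ncard_union_le _ _).trans (add_le_add ?_ (DL.S_preimage _ _ _ _))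
    rw [Set.ncard_pair (by norm_num)]
  have hfinal : (_ : ℝ) ≤ _ := Nat.cast_le (α := ℝ).mpr (hc.trans hu)
  refine hfinal.trans ?_
  push_cast
  have e : (2 + K1 + K2 + K3 + K4) * X / Real.log X ^ ((1 : ℝ) / 40) =
      2 * (X / Real.log X ^ ((1 : ℝ) / 40)) + K1 * X / Real.log X ^ ((1 : ℝ) / 40) +
      K2 * X / Real.log X ^ ((1 : ℝ) / 40) + K3 * X / Real.log X ^ ((1 : ℝ) / 40) +
      K4 * X / Real.log X ^ ((1 : ℝ) / 40) := by ring
  rw [e]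
  linarith [h1 X hX, h2 X hX, h3 X hX, h4 X hX]
end

section
/- Let A, B, C be positive integers with gcd(A, B) = 1, and let l(x,y) = A·x·y + B·x + C·y. Then there exists a constant c > 0 (depending on A, B, C) such that for all real X ≥ 2, the number of positive integers n ≤ X for which there do NOT exist positive integers x, y with n = l(x,y) is at most c·X·(log X)^(−1/φ(A)), where φ is Euler's totient function. In particular, l represents a density-one subset of the positive integers. -/
open Classical in
/-- Indicator of the positive integers free of divisors from `P`. -/
noncomputable def freeInd (P : Set ℕ) : ArithmeticFunction ℝ :=
  ⟨fun n => if n ≠ 0 ∧ ∀ p ∈ P, ¬ p ∣ n then 1 else 0, by simp⟩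

lemma freeInd_apply (P : Set ℕ) (n : ℕ) [Decidable (n ≠ 0 ∧ ∀ p ∈ P, ¬ p ∣ n)] :
    freeInd P n = if n ≠ 0 ∧ ∀ p ∈ P, ¬ p ∣ n then 1 else 0 := by
  simp only [freeInd, ArithmeticFunction.coe_mk]
  congr

lemma freeInd_nonneg (P : Set ℕ) (n : ℕ) : 0 ≤ freeInd P n := by
  classical
  rw [freeInd_apply]; split_ifs <;> norm_num

lemma freeInd_le_one (P : Set ℕ) (n : ℕ) : freeInd P n ≤ 1 := by
  classical
  rw [freeInd_apply]; split_ifs <;> norm_num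

lemma freeInd_le_of_dvd (P : Set ℕ) {m n : ℕ} (h : m ∣ n) : freeInd P n ≤ freeInd P m := by
  classical
  rw [freeInd_apply, freeInd_apply]
  split_ifs with h1 h2 h2
  · rfl
  · exfalso
    apply h2
    refine ⟨fun h0 => h1.1 ?_, fun p hp hpm => h1.2 p hp (hpm.trans h)⟩
    subst h0
    exact zero_dvd_iff.mp h
  · norm_num
  · rfl

open Finset in
lemma freeInd_sum_log (P : Set ℕ) (N : ℕ) (hN : 0 < N) :
    (∑ n ∈ Ioc 0 N, freeInd P n) * Real.log N ≤
      (Real.log 4 + 5) * N * ∑ n ∈ Ioc 0 N, freeInd P n / n := by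
  have h1 : ∑ n ∈ Ioc 0 N, freeInd P n * Real.log n ≤
      (Real.log 4 + 4) * N * ∑ n ∈ Ioc 0 N, freeInd P n / n := by
    calc ∑ n ∈ Ioc 0 N, freeInd P n * Real.log n
        ≤ ∑ n ∈ Ioc 0 N, (freeInd P * ArithmeticFunction.vonMangoldt) n := by
          refine sum_le_sum fun n hn => ?_
          rw [ArithmeticFunction.mul_apply, ← ArithmeticFunction.vonMangoldt_sum,
            ← Nat.sum_divisorsAntidiagonal' (f := fun _ i => ArithmeticFunction.vonMangoldt i), mul_sum]
          refine sum_le_sum fun x hx => ?_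
          have hx' := (Nat.mem_divisorsAntidiagonal.mp hx).1
          exact mul_le_mul_of_nonneg_right
            (freeInd_le_of_dvd P (Dvd.intro _ hx')) ArithmeticFunction.vonMangoldt_nonneg
      _ = ∑ n ∈ Ioc 0 N, freeInd P n * ∑ m ∈ Ioc 0 (N / n), ArithmeticFunction.vonMangoldt m :=
          ArithmeticFunction.sum_Ioc_mul_eq_sum_sum _ _ _
      _ ≤ ∑ n ∈ Ioc 0 N, (Real.log 4 + 4) * N * (freeInd P n / n) := by
          refine sum_le_sum fun n hn => ?_
          have : ∑ m ∈ Ioc 0 (N / n), ArithmeticFunction.vonMangoldt m ≤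
              (Real.log 4 + 4) * (N / n : ℝ) := by
            have := Chebyshev.psi_le_const_mul_self (x := (N / n : ℝ)) (by positivity)
            rw [Chebyshev.psi, Nat.floor_div_eq_div] at this
            exact this
          calc _ ≤ freeInd P n * ((Real.log 4 + 4) * (N / n : ℝ)) :=
                mul_le_mul_of_nonneg_left this (freeInd_nonneg P n)
            _ = _ := by ring
      _ = _ := by rw [mul_sum]
  have h2 : (∑ n ∈ Ioc 0 N, freeInd P n) * Real.log N ≤
      ∑ n ∈ Ioc 0 N, (freeInd P n * Real.log n + N * (freeInd P n / n)) := by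
    rw [sum_mul]
    refine sum_le_sum fun n hn => ?_
    have hn0 : (0 : ℝ) < n := by exact_mod_cast (mem_Ioc.mp hn).1
    have hN0 : (0 : ℝ) < N := by exact_mod_cast hN
    have : Real.log N ≤ Real.log n + N / n := by
      have := Real.log_le_self (x := (N / n : ℝ)) (by positivity)
      rw [Real.log_div hN0.ne' hn0.ne'] at this
      linarith
    calc _ ≤ freeInd P n * (Real.log n + N / n) :=
          mul_le_mul_of_nonneg_left this (freeInd_nonneg P n)
      _ = _ := by ring
  rw [sum_add_distrib, ← mul_sum] at h2
  linarith

/-- Completely multiplicative version with `n ^ (-s)`. -/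
noncomputable def freeHom (P : Set ℕ) (hP : ∀ p ∈ P, p.Prime) (s : ℝ) (hs : 1 < s) : ℕ →*₀ ℝ where
  toFun n := freeInd P n * (n : ℝ) ^ (-s)
  map_zero' := by simp
  map_one' := by
    classical
    rw [freeInd_apply, if_pos]
    · simp
    · exact ⟨one_ne_zero, fun p hp h => (hP p hp).one_lt.ne' (Nat.dvd_one.mp h)⟩
  map_mul' m n := by
    classical
    have : freeInd P (m * n) = freeInd P m * freeInd P n := by
      simp only [freeInd_apply]
      rw [ite_zero_mul_ite_zero, mul_one]
      congr 1
      apply propext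
      constructor
      · rintro ⟨h0, h⟩
        exact ⟨⟨left_ne_zero_of_mul h0, fun p hp hd => h p hp (hd.mul_right n)⟩,
          ⟨right_ne_zero_of_mul h0, fun p hp hd => h p hp (hd.mul_left m)⟩⟩
      · rintro ⟨⟨h0, h⟩, ⟨h0', h'⟩⟩
        refine ⟨mul_ne_zero h0 h0', fun p hp hd => ?_⟩
        rcases (hP p hp).dvd_mul.mp hd with h1 | h1
        exacts [h p hp h1, h' p hp h1]
    rw [this, Nat.cast_mul, Real.mul_rpow (by positivity) (by positivity)]
    ring

lemma summable_freeHom (P : Set ℕ) (hP : ∀ p ∈ P, p.Prime) (s : ℝ) (hs : 1 < s) :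
    Summable (fun n => ‖freeHom P hP s hs n‖) := by
  refine Summable.of_nonneg_of_le (fun n => norm_nonneg _) (fun n => ?_)
    (Real.summable_nat_rpow.mpr (show -s < -1 by linarith))
  change ‖freeInd P n * (n : ℝ) ^ (-s)‖ ≤ _
  rw [Real.norm_of_nonneg (mul_nonneg (freeInd_nonneg P n) (by positivity))]
  exact mul_le_of_le_one_left (by positivity) (freeInd_le_one P n)

lemma summable_indP (P : Set ℕ) (s : ℝ) (hs : 1 < s) :
    Summable (P.indicator (fun n : ℕ => (n : ℝ) ^ (-s))) :=
  (Real.summable_nat_rpow.mpr (show -s < -1 by linarith)).indicator P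

lemma tsum_freeInd_le (P : Set ℕ) (hP : ∀ p ∈ P, p.Prime) (s : ℝ) (hs : 1 < s) :
    ∑' n : ℕ, freeInd P n * (n : ℝ) ^ (-s) ≤
      (∑' n : ℕ, 1 / (n : ℝ) ^ s) * Real.exp (-∑' n, P.indicator (fun n : ℕ => (n : ℝ) ^ (-s)) n) := by
  classical
  have t1 := EulerProduct.eulerProduct_completely_multiplicative (summable_freeHom P hP s hs)
  have t2 := EulerProduct.eulerProduct_completely_multiplicative
    (summable_freeHom ∅ (by simp) s hs)
  have e2 : ∑' n, freeHom ∅ (by simp) s hs n = ∑' n : ℕ, 1 / (n : ℝ) ^ s := by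
    refine tsum_congr fun n => ?_
    change freeInd ∅ n * (n : ℝ) ^ (-s) = _
    rw [Real.rpow_neg (by positivity), freeInd_apply]
    rcases eq_or_ne n 0 with rfl | h
    · simp [Real.zero_rpow (by linarith : s ≠ 0)]
    · simp [h]
  rw [e2] at t2
  have t3 := ((summable_indP P s hs).hasSum.tendsto_sum_nat).neg.rexp
  refine le_of_tendsto_of_tendsto' t1 (t2.mul t3) fun n => ?_
  rw [← Finset.sum_neg_distrib, Real.exp_sum]
  have hsub : Nat.primesBelow n ⊆ Finset.range n := Finset.filter_subset _ _
  have e3 : ∏ i ∈ Finset.range n, Real.exp (-P.indicator (fun n : ℕ => (n : ℝ) ^ (-s)) i) =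
      ∏ i ∈ Nat.primesBelow n, Real.exp (-P.indicator (fun n : ℕ => (n : ℝ) ^ (-s)) i) := by
    symm
    refine Finset.prod_subset hsub fun x hx hx' => ?_
    have : x ∉ P := fun h => hx' (by
      rw [Nat.mem_primesBelow]; exact ⟨Finset.mem_range.mp hx, hP x h⟩)
    simp [this]
  rw [e3, ← Finset.prod_mul_distrib]
  refine Finset.prod_le_prod ?_ ?_
  all_goals
    intro p hp
    have hpp := (Nat.mem_primesBelow.mp hp).2
    have hp1 : (p : ℝ) ^ (-s) < 1 := Real.rpow_lt_one_of_one_lt_of_neg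
      (by exact_mod_cast hpp.one_lt) (by linarith)
    have hp0 : 0 ≤ (p : ℝ) ^ (-s) := by positivity
  · change 0 ≤ (1 - freeInd P p * (p : ℝ) ^ (-s))⁻¹
    have := mul_le_of_le_one_left hp0 (freeInd_le_one P p)
    exact inv_nonneg.mpr (by linarith)
  · change (1 - freeInd P p * (p : ℝ) ^ (-s))⁻¹ ≤ (1 - freeInd ∅ p * (p : ℝ) ^ (-s))⁻¹ * _
    have h1 : freeInd ∅ p = 1 := by rw [freeInd_apply]; simp [hpp.ne_zero]
    rw [h1, one_mul]
    by_cases hpP : p ∈ P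
    · have h2 : freeInd P p = 0 := by
        rw [freeInd_apply, if_neg]
        exact fun h => h.2 p hpP dvd_rfl
      rw [h2, Set.indicator_of_mem hpP, inv_mul_eq_div, le_div_iff₀ (by linarith)]
      have := Real.add_one_le_exp (-(p : ℝ) ^ (-s))
      simp only [zero_mul, sub_zero, inv_one, one_mul]
      linarith
    · rw [Set.indicator_of_notMem hpP]
      have h2 : freeInd P p = 1 := by
        rw [freeInd_apply, if_pos]
        refine ⟨hpp.ne_zero, fun q hq hd => hpP ?_⟩
        rwa [← (Nat.prime_dvd_prime_iff_eq (hP q hq) hpp).mp hd]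
      rw [h2]; simp
open Complex in
lemma hasDerivAt_indP (P : Set ℕ) (h0 : 0 ∉ P) (s : ℝ) (hs : 1 < s) :
    Summable (P.indicator (fun n : ℕ => Real.log n * (n : ℝ) ^ (-s))) ∧
    HasDerivAt (fun s : ℝ => ∑' n, P.indicator (fun n : ℕ => (n : ℝ) ^ (-s)) n)
      (-∑' n, P.indicator (fun n : ℕ => Real.log n * (n : ℝ) ^ (-s)) n) s := by
  classical
  set f : ℕ → ℂ := P.indicator (fun _ => (1 : ℂ)) with hf
  have term_eq (x : ℝ) (n : ℕ) : LSeries.term f x n =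
      ((P.indicator (fun n : ℕ => (n : ℝ) ^ (-x)) n : ℝ) : ℂ) := by
    by_cases hn : n ∈ P
    · have : n ≠ 0 := fun h => h0 (h ▸ hn)
      rw [LSeries.term_of_ne_zero this, hf, Set.indicator_of_mem hn, Set.indicator_of_mem hn,
        Complex.ofReal_cpow (by positivity), one_div, ← Complex.cpow_neg]
      simp
    · simp [LSeries.term, hf, hn]
  have term_eq' (x : ℝ) (n : ℕ) : LSeries.term (LSeries.logMul f) x n =
      ((P.indicator (fun n : ℕ => Real.log n * (n : ℝ) ^ (-x)) n : ℝ) : ℂ) := by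
    by_cases hn : n ∈ P
    · have : n ≠ 0 := fun h => h0 (h ▸ hn)
      rw [LSeries.term_of_ne_zero this, LSeries.logMul, hf, Set.indicator_of_mem hn,
        Set.indicator_of_mem hn, Complex.ofReal_mul,
        Complex.ofReal_cpow (by positivity), mul_one, div_eq_mul_inv, ← Complex.cpow_neg]
      simp
    · simp [LSeries.term, hf, hn]
  have habs : LSeries.abscissaOfAbsConv f ≤ 1 := by
    refine LSeries.abscissaOfAbsConv_le_of_forall_lt_LSeriesSummable fun y hy => ?_
    unfold LSeriesSummable
    simp_rw [funext (term_eq y)]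
    exact Complex.summable_ofReal.mpr (summable_indP P y hy)
  have hlt : LSeries.abscissaOfAbsConv f < ((s : ℂ)).re := by
    refine habs.trans_lt ?_
    simp only [Complex.ofReal_re]
    exact_mod_cast hs
  constructor
  · have := LSeriesSummable_logMul_of_lt_re hlt
    unfold LSeriesSummable at this
    simp_rw [funext (term_eq' s)] at this
    exact Complex.summable_ofReal.mp this
  · have := (LSeries_hasDerivAt hlt).real_of_complex
    convert! this using 1
    · ext x
      rw [LSeries, funext (term_eq x), ← Complex.ofReal_tsum, Complex.ofReal_re]
    · rw [LSeries, funext (term_eq' s), ← Complex.ofReal_tsum, ← Complex.ofReal_neg,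
        Complex.ofReal_re]

/-- The primes `p > B` in the residue class `a` modulo `q`. -/
def primesAP (q : ℕ) (a : ZMod q) (B : ℕ) : Set ℕ := {p | p.Prime ∧ (p : ZMod q) = a ∧ B < p}

open ArithmeticFunction.vonMangoldt in
lemma sum_primesAP_log_lower (q : ℕ) [NeZero q] (a : ZMod q) (ha : IsUnit a) (B : ℕ) :
    ∃ K : ℝ, ∀ s : ℝ, 1 < s → s ≤ 2 → (q.totient : ℝ)⁻¹ / (s - 1) - K ≤
      ∑' n, (primesAP q a B).indicator (fun n : ℕ => Real.log n * (n : ℝ) ^ (-s)) n := by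
  classical
  obtain ⟨C, hC⟩ := LSeries_residueClass_lower_bound ha
  set P := primesAP q a B with hP
  have h0 : 0 ∉ P := fun h => Nat.not_prime_zero h.1
  set rest : ℕ → ℝ := fun n => if n ∈ P then 0 else residueClass a n with hrest
  have rest_nonneg (n) : 0 ≤ rest n := by
    simp only [hrest]; split_ifs
    exacts [le_rfl, residueClass_nonneg a n]
  have hsum : Summable fun n : ℕ => rest n / n := by
    refine (summable_residueClass_non_primes_div a).congr_cofinite ?_
    rw [Nat.cofinite_eq_atTop]
    filter_upwards [Filter.eventually_gt_atTop B] with n hn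
    congr 1
    simp only [hrest]
    by_cases hp : n.Prime
    · by_cases hna : (n : ZMod q) = a
      · rw [if_pos hp, if_pos ⟨hp, hna, hn⟩]
      · rw [if_pos hp, if_neg (fun h => hna h.2.1), residueClass, Set.indicator_of_notMem]
        exact hna
    · rw [if_neg hp, if_neg (fun h => hp h.1)]
  refine ⟨C + ∑' n : ℕ, rest n / n, fun s hs hs2 => ?_⟩
  have hle (n : ℕ) : rest n * (n : ℝ) ^ (-s) ≤ rest n / n := by
    rcases Nat.eq_zero_or_pos n with rfl | hn
    · simp [Real.zero_rpow (by linarith : -s ≠ 0)]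
    · rw [div_eq_mul_inv, ← Real.rpow_neg_one]
      refine mul_le_mul_of_nonneg_left ?_ (rest_nonneg n)
      exact Real.rpow_le_rpow_of_exponent_le (by exact_mod_cast hn) (by linarith)
  have hsum2 : Summable fun n : ℕ => rest n * (n : ℝ) ^ (-s) :=
    Summable.of_nonneg_of_le (fun n => mul_nonneg (rest_nonneg n) (by positivity)) hle hsum
  have h1 := hC (x := s) ⟨hs, hs2⟩
  have h2 : ∑' n, residueClass a n / (n : ℝ) ^ s =
      ∑' n, P.indicator (fun n : ℕ => Real.log n * (n : ℝ) ^ (-s)) n +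
      ∑' n : ℕ, rest n * (n : ℝ) ^ (-s) := by
    rw [← (hasDerivAt_indP P h0 s hs).1.tsum_add hsum2]
    refine tsum_congr fun n => ?_
    rw [Real.rpow_neg (by positivity), ← div_eq_mul_inv]
    by_cases hn : n ∈ P
    · rw [Set.indicator_of_mem hn]
      simp only [hrest, if_pos hn, zero_div, add_zero]
      rw [residueClass, Set.indicator_of_mem (show n ∈ {n : ℕ | (n : ZMod q) = a} from hn.2.1),
        ArithmeticFunction.vonMangoldt_apply_prime hn.1, Real.rpow_neg (by positivity),
        div_eq_mul_inv]
    · rw [Set.indicator_of_notMem hn]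
      simp only [hrest, if_neg hn, zero_add]
  have h3 : ∑' n : ℕ, rest n * (n : ℝ) ^ (-s) ≤ ∑' n : ℕ, rest n / n :=
    hsum2.tsum_le_tsum hle hsum
  linarith

lemma sum_primesAP_lower (q : ℕ) [NeZero q] (a : ZMod q) (ha : IsUnit a) (B : ℕ) :
    ∃ K : ℝ, ∀ s : ℝ, 1 < s → s ≤ 2 → -((q.totient : ℝ)⁻¹ * Real.log (s - 1)) - K ≤
      ∑' n, (primesAP q a B).indicator (fun n : ℕ => (n : ℝ) ^ (-s)) n := by
  obtain ⟨K, hK⟩ := sum_primesAP_log_lower q a ha B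
  set P := primesAP q a B with hP
  have h0 : 0 ∉ P := fun h => Nat.not_prime_zero h.1
  set h : ℝ → ℝ := fun s => ∑' n, P.indicator (fun n : ℕ => (n : ℝ) ^ (-s)) n with hh
  set g : ℝ → ℝ := fun s => h s + (q.totient : ℝ)⁻¹ * Real.log (s - 1) - K * s with hg
  have hder (s : ℝ) (hs : 1 < s) : HasDerivAt g
      (-∑' n, P.indicator (fun n : ℕ => Real.log n * (n : ℝ) ^ (-s)) n +
        (q.totient : ℝ)⁻¹ * (1 / (s - 1)) - K * 1) s := by
    refine ((hasDerivAt_indP P h0 s hs).2.add (HasDerivAt.const_mul _ ?_)).sub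
      ((hasDerivAt_id s).const_mul K)
    exact ((hasDerivAt_id s).sub_const 1).log (by simp only [id]; linarith)
  have hanti : AntitoneOn g (Set.Ioc 1 2) := by
    refine antitoneOn_of_deriv_nonpos (convex_Ioc 1 2)
      (fun s hs => (hder s hs.1).continuousAt.continuousWithinAt) ?_ ?_
    · rw [interior_Ioc]
      exact fun s hs => (hder s hs.1).differentiableAt.differentiableWithinAt
    · rw [interior_Ioc]
      intro s hs
      rw [(hder s hs.1).deriv]
      have := hK s hs.1 hs.2.le
      rw [div_eq_mul_one_div] at this
      linarith
  refine ⟨|K| * 2 + |K| * 2, fun s hs hs2 => ?_⟩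
  have h1 := hanti ⟨hs, hs2⟩ (show (2 : ℝ) ∈ Set.Ioc 1 2 by norm_num) hs2
  have h2 : 0 ≤ h 2 := tsum_nonneg fun n => Set.indicator_nonneg (fun n _ => by positivity) n
  simp only [hg] at h1
  rw [show (2 : ℝ) - 1 = 1 by norm_num, Real.log_one, mul_zero] at h1
  have h3 : K * 2 ≤ |K| * 2 := by linarith [le_abs_self K]
  have h4 : -(K * s) ≤ |K| * 2 := by nlinarith [neg_abs_le K, abs_nonneg K]
  change _ ≤ h s
  linarith

open Finset Filter Topology in
lemma freeInd_count (q : ℕ) [NeZero q] (a : ZMod q) (ha : IsUnit a) (B : ℕ) :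
    ∃ K : ℝ, 0 ≤ K ∧ ∀ᶠ N : ℕ in atTop, ∑ n ∈ Ioc 0 N, freeInd (primesAP q a B) n ≤
      K * N * Real.log N ^ (-(1 / (q.totient : ℝ))) := by
  obtain ⟨K, hK⟩ := sum_primesAP_lower q a ha B
  set P := primesAP q a B with hP
  have hPp : ∀ p ∈ P, p.Prime := fun p h => h.1
  have hc0 : (0 : ℝ) ≤ Real.log 4 + 5 := by
    have := Real.log_nonneg (show (1 : ℝ) ≤ 4 by norm_num)
    linarith
  refine ⟨(Real.log 4 + 5) * (Real.exp 1 * (2 * Real.exp K)), by positivity, ?_⟩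
  have hlog : Tendsto (fun N : ℕ => Real.log N) atTop atTop :=
    Real.tendsto_log_atTop.comp tendsto_natCast_atTop_atTop
  have hs1 : Tendsto (fun N : ℕ => 1 + 1 / Real.log N) atTop (𝓝[>] 1) := by
    refine tendsto_nhdsWithin_iff.mpr ⟨?_, ?_⟩
    · have : Tendsto (fun N : ℕ => 1 / Real.log N) atTop (𝓝 0) := hlog.const_div_atTop 1
      simpa using this.const_add 1
    · filter_upwards [hlog.eventually_ge_atTop 1] with N hN
      simp only [Set.mem_Ioi]
      have : 0 < 1 / Real.log N := by positivity
      linarith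
  have hz := (tendsto_sub_mul_tsum_nat_rpow.comp hs1).eventually
    (eventually_le_nhds (show (1 : ℝ) < 2 by norm_num))
  filter_upwards [hlog.eventually_ge_atTop 1, hz, eventually_gt_atTop 0] with N hL hzN hN0
  set L := Real.log N with hLdef
  set s := 1 + 1 / L with hs
  have hLpos : 0 < L := by linarith
  have hs_gt : 1 < s := by
    have : 0 < 1 / L := by positivity
    linarith
  have hs_le : s ≤ 2 := by
    have : 1 / L ≤ 1 := by rw [div_le_one hLpos]; exact hL
    linarith
  have hNpos : (0 : ℝ) < N := by exact_mod_cast hN0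
  have h1 := freeInd_sum_log P N hN0
  have hsm : Summable fun n : ℕ => freeInd P n * (n : ℝ) ^ (-s) :=
    (summable_freeHom P hPp s hs_gt).of_norm
  have h2 : ∑ n ∈ Ioc 0 N, freeInd P n / n ≤
      Real.exp 1 * ∑' n : ℕ, freeInd P n * (n : ℝ) ^ (-s) := by
    calc ∑ n ∈ Ioc 0 N, freeInd P n / n
        ≤ ∑ n ∈ Ioc 0 N, Real.exp 1 * (freeInd P n * (n : ℝ) ^ (-s)) := by
          refine sum_le_sum fun n hn => ?_
          have hn0 : (0 : ℝ) < n := by exact_mod_cast (mem_Ioc.mp hn).1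
          have hnN : (n : ℝ) ≤ N := by exact_mod_cast (mem_Ioc.mp hn).2
          have e1 : (n : ℝ)⁻¹ = (n : ℝ) ^ (1 / L) * (n : ℝ) ^ (-s) := by
            rw [← Real.rpow_add hn0, ← Real.rpow_neg_one]
            congr 1
            rw [hs]; ring
          have e2 : (n : ℝ) ^ (1 / L) ≤ Real.exp 1 := by
            calc (n : ℝ) ^ (1 / L) ≤ (N : ℝ) ^ (1 / L) :=
                  Real.rpow_le_rpow hn0.le hnN (by positivity)
              _ = Real.exp 1 := by
                  rw [Real.rpow_def_of_pos hNpos, ← hLdef, mul_one_div_cancel hLpos.ne']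
          rw [div_eq_mul_inv, e1]
          have := mul_le_mul_of_nonneg_right e2
            (mul_nonneg (freeInd_nonneg P n) (Real.rpow_nonneg hn0.le (-s)))
          linarith
      _ = Real.exp 1 * ∑ n ∈ Ioc 0 N, (freeInd P n * (n : ℝ) ^ (-s)) := by rw [mul_sum]
      _ ≤ _ := by
          refine mul_le_mul_of_nonneg_left ?_ (by positivity)
          exact hsm.sum_le_tsum _ fun n _ => mul_nonneg (freeInd_nonneg P n) (by positivity)
  have h3 := tsum_freeInd_le P hPp s hs_gt
  have hs1' : s - 1 = 1 / L := by rw [hs]; ring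
  have h4 : ∑' n : ℕ, 1 / (n : ℝ) ^ s ≤ 2 * L := by
    have hz' : (s - 1) * ∑' n : ℕ, 1 / (n : ℝ) ^ s ≤ 2 := hzN
    rw [hs1', one_div, inv_mul_le_iff₀ hLpos] at hz'
    linarith
  have h5 : Real.exp (-∑' n, P.indicator (fun n : ℕ => (n : ℝ) ^ (-s)) n) ≤
      Real.exp K * L ^ (-(1 / (q.totient : ℝ))) := by
    rw [Real.rpow_def_of_pos hLpos, ← Real.exp_add]
    refine Real.exp_le_exp.mpr ?_
    have := hK s hs_gt hs_le
    rw [hs1', one_div, Real.log_inv] at this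
    rw [one_div]
    linarith
  have h6 : ∑' n : ℕ, freeInd P n * (n : ℝ) ^ (-s) ≤
      2 * L * (Real.exp K * L ^ (-(1 / (q.totient : ℝ)))) :=
    h3.trans (mul_le_mul h4 h5 (by positivity) (by positivity))
  have h7 : (∑ n ∈ Ioc 0 N, freeInd P n) * L ≤ ((Real.log 4 + 5) * (Real.exp 1 * (2 * Real.exp K)) *
      N * L ^ (-(1 / (q.totient : ℝ)))) * L := by
    calc _ ≤ _ := h1
      _ ≤ (Real.log 4 + 5) * N *
          (Real.exp 1 * (2 * L * (Real.exp K * L ^ (-(1 / (q.totient : ℝ)))))) := by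
        refine mul_le_mul_of_nonneg_left (h2.trans ?_) (by positivity)
        exact mul_le_mul_of_nonneg_left h6 (by positivity)
      _ = _ := by ring
  exact le_of_mul_le_mul_right h7 hLpos

lemma primeCounting_bound {N : ℕ} (hL : 1 ≤ Real.log N) (α : ℝ) (hα : α ≤ 1) :
    (Nat.primeCounting N : ℝ) ≤ (2 * Real.log 4 + 2) * N * Real.log N ^ (-α) := by
  have hN1 : (1 : ℝ) < N := by
    by_contra h
    have := Real.log_nonpos (by positivity) (not_lt.mp h)
    linarith
  have h := Chebyshev.pi_le_log4_mul_div hN1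
  rw [Nat.floor_natCast] at h
  set L := Real.log N with hLdef
  have hLpos : 0 < L := by linarith
  have h1 : Real.log (√(N : ℝ)) = L / 2 := Real.log_sqrt (by positivity)
  have hsq : 0 < √(N : ℝ) := Real.sqrt_pos.mpr (by linarith)
  have h2 : L / 2 ≤ √(N : ℝ) := by rw [← h1]; exact Real.log_le_self hsq.le
  have h3 : √(N : ℝ) ≤ 2 * N / L := by
    rw [le_div_iff₀ hLpos]
    have := Real.mul_self_sqrt (show (0 : ℝ) ≤ N by positivity)
    nlinarith
  have h4 : L⁻¹ ≤ L ^ (-α) := by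
    rw [← Real.rpow_neg_one]
    exact Real.rpow_le_rpow_of_exponent_le hL (by linarith)
  rw [h1] at h
  have hl4 : 0 ≤ Real.log 4 := Real.log_nonneg (by norm_num)
  calc (Nat.primeCounting N : ℝ) ≤ Real.log 4 * N / (L / 2) + √(N : ℝ) := h
    _ ≤ Real.log 4 * N / (L / 2) + 2 * N / L := by linarith
    _ = (2 * Real.log 4 + 2) * N * L⁻¹ := by field_simp
    _ ≤ _ := mul_le_mul_of_nonneg_left h4 (by positivity)

/-- A divisor of `A n + B C` in the right residue class gives a representation. -/
lemma represented_of_factor (A B C n p k : ℕ) (hA : 0 < A) (hAB : Nat.gcd A B = 1)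
    (hp : (p : ZMod A) = (B : ZMod A)) (hpB : B < p) (hk : C < k)
    (h : A * n + B * C = p * k) :
    ∃ x y : ℕ, 0 < x ∧ 0 < y ∧ n = A * x * y + B * x + C * y := by
  have hpm : B ≡ p [MOD A] := ((ZMod.natCast_eq_natCast_iff _ _ _).mp hp).symm
  have hkm : C ≡ k [MOD A] := by
    have h1 : B * C ≡ B * k [MOD A] := by
      have h2 : A * n + B * C ≡ B * C [MOD A] := by
        simp [Nat.ModEq, Nat.mul_add_mod]
      exact (h2.symm.trans (h ▸ Nat.ModEq.refl _)).trans (hpm.symm.mul_right k)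
    exact Nat.ModEq.cancel_left_of_coprime hAB h1
  obtain ⟨y, hy⟩ := (Nat.modEq_iff_dvd' hpB.le).mp hpm
  obtain ⟨x, hx⟩ := (Nat.modEq_iff_dvd' hk.le).mp hkm
  have hp' : p = A * y + B := by omega
  have hk' : k = A * x + C := by omega
  refine ⟨x, y, ?_, ?_, ?_⟩
  · rcases Nat.eq_zero_or_pos x with rfl | hx0
    · simp at hx; omega
    · exact hx0
  · rcases Nat.eq_zero_or_pos y with rfl | hy0
    · simp at hy; omega
    · exact hy0
  · subst hp' hk'
    refine Nat.eq_of_mul_eq_mul_left hA ?_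
    have : A * n + B * C = A * (A * x * y + B * x + C * y) + B * C := by rw [h]; ring
    omega

open Finset in
lemma unrepresented_count (A B C M : ℕ) (hA : 0 < A) (hB : 0 < B) (hC : 0 < C)
    (hAB : Nat.gcd A B = 1) (T : Set ℕ) (hT : ∀ n ∈ T, n ≤ M ∧
      ¬∃ x y : ℕ, 0 < x ∧ 0 < y ∧ n = A * x * y + B * x + C * y) :
    (T.ncard : ℝ) ≤ ∑ n ∈ Ioc 0 (A * M + B * C), freeInd (primesAP A (B : ZMod A) B) n +
      (C + 1) * Nat.primeCounting (A * M + B * C) := by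
  classical
  set Y := A * M + B * C with hY
  set P := primesAP A (B : ZMod A) B with hP
  set U : Finset ℕ := {n ∈ Ioc 0 Y | n ≠ 0 ∧ ∀ p ∈ P, ¬ p ∣ n} with hU
  set V : Finset ℕ := (Nat.primesLE Y ×ˢ range (C + 1)).image (fun x => x.1 * x.2) with hV
  have hsumU : ∑ n ∈ Ioc 0 Y, freeInd P n = U.card := by
    simp_rw [freeInd_apply]
    rw [sum_boole]
  have hinj : Function.Injective (fun n : ℕ => A * n + B * C) := by
    intro m n hmn
    exact Nat.eq_of_mul_eq_mul_left hA (Nat.add_right_cancel hmn)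
  have hsub : Set.image (fun n : ℕ => A * n + B * C) T ⊆ ((U ∪ V : Finset ℕ) : Set ℕ) := by
    rintro _ ⟨n, hn, rfl⟩
    obtain ⟨hnM, hrep⟩ := hT n hn
    have hBC : 0 < B * C := Nat.mul_pos hB hC
    have hle : A * n + B * C ≤ Y := by
      have := Nat.mul_le_mul_left A hnM
      omega
    have hpos : 0 < A * n + B * C := by omega
    simp only [coe_union, Set.mem_union, mem_coe]
    by_cases hfree : ∀ p ∈ P, ¬ p ∣ A * n + B * C
    · left
      simp only [hU, mem_filter, mem_Ioc]
      exact ⟨⟨hpos, hle⟩, hpos.ne', hfree⟩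
    · right
      push Not at hfree
      obtain ⟨p, hpP, k, hk⟩ := hfree
      have hkC : k ≤ C := by
        by_contra hkC
        exact hrep (represented_of_factor A B C n p k hA hAB hpP.2.1 hpP.2.2 (by omega) hk)
      have hk0 : 0 < k := by
        rcases Nat.eq_zero_or_pos k with rfl | h
        · simp at hk; omega
        · exact h
      simp only [hV, mem_image, mem_product, mem_range, Prod.exists]
      refine ⟨p, k, ⟨?_, by omega⟩, hk.symm⟩
      rw [Nat.mem_primesLE]
      exact ⟨(Nat.le_mul_of_pos_right p hk0).trans (hk ▸ hle), hpP.1⟩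
  have h1 : T.ncard ≤ (U ∪ V).card := by
    rw [← Set.ncard_image_of_injective T hinj, ← Set.ncard_coe_finset]
    exact Set.ncard_le_ncard hsub (Finset.finite_toSet _)
  have h2 : V.card ≤ Nat.primeCounting Y * (C + 1) := by
    refine card_image_le.trans ?_
    rw [card_product, card_range, Nat.primesLE_card_eq_primeCounting]
  have h3 : T.ncard ≤ U.card + Nat.primeCounting Y * (C + 1) :=
    h1.trans ((card_union_le _ _).trans (Nat.add_le_add_left h2 _))
  rw [hsumU]
  have h4 : (T.ncard : ℝ) ≤ ((U.card + Nat.primeCounting Y * (C + 1) : ℕ) : ℝ) := by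
    exact_mod_cast h3
  push_cast at h4
  linarith

/-- The quadratic polynomial `l(x,y) = Axy + Bx + Cy` with `A, B, C > 0` and
`gcd(A,B) = 1` represents a density-one subset of the positive integers:
the number of positive `n ≤ X` not represented is `≤ c·X·(log X)^(−1/φ(A))`. -/
theorem quadratic_represents_density_one (A B C : ℕ) (hA : 0 < A) (hB : 0 < B)
    (hC : 0 < C) (hAB : Nat.gcd A B = 1) :
    ∃ c : ℝ, 0 < c ∧ ∀ X : ℝ, 2 ≤ X →
      ({n : ℕ | 0 < n ∧ (n : ℝ) ≤ X ∧
          ¬∃ x y : ℕ, 0 < x ∧ 0 < y ∧ n = A * x * y + B * x + C * y}.ncard : ℝ)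
        ≤ c * X * Real.log X ^ (-(1 / (A.totient : ℝ))) := by
  haveI : NeZero A := ⟨hA.ne'⟩
  have hunit : IsUnit (B : ZMod A) := by
    rw [ZMod.isUnit_iff_coprime]
    exact Nat.Coprime.symm hAB
  obtain ⟨K, hK0, hK⟩ := freeInd_count A (B : ZMod A) hunit B
  obtain ⟨N0, hN0⟩ := Filter.eventually_atTop.mp hK
  set α : ℝ := 1 / (A.totient : ℝ) with hα
  have htot : (1 : ℝ) ≤ A.totient := by exact_mod_cast Nat.totient_pos.mpr hA
  have hα0 : 0 ≤ α := by positivity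
  have hα1 : α ≤ 1 := by rw [hα, div_le_one (by linarith)]; exact htot
  have hl4 : 0 ≤ Real.log 4 := Real.log_nonneg (by norm_num)
  set X0 : ℝ := max N0 (max 2 (Real.exp 1)) with hX0
  have hX0l : 0 ≤ Real.log X0 :=
    Real.log_nonneg (by have := (le_max_left 2 (Real.exp 1)).trans (le_max_right (N0 : ℝ) _); linarith)
  set c1 : ℝ := (K + (C + 1) * (2 * Real.log 4 + 2)) * (A + B * C) with hc1
  have hc1' : 0 ≤ c1 := by positivity
  refine ⟨c1 + Real.log X0 ^ α + 1, by positivity, fun X hX => ?_⟩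
  set T : Set ℕ := {n : ℕ | 0 < n ∧ (n : ℝ) ≤ X ∧
          ¬∃ x y : ℕ, 0 < x ∧ 0 < y ∧ n = A * x * y + B * x + C * y} with hT
  have hlX : 0 < Real.log X := Real.log_pos (by linarith)
  have hX0' : 0 ≤ X := by linarith
  have hpow : 0 ≤ X * Real.log X ^ (-α) := by positivity
  by_cases hbig : X0 ≤ X
  · set M := ⌊X⌋₊ with hM
    set Y := A * M + B * C with hY
    have hcount := unrepresented_count A B C M hA hB hC hAB T
      (fun n hn => ⟨Nat.le_floor hn.2.1, hn.2.2⟩)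
    have hMX : (M : ℝ) ≤ X := Nat.floor_le hX0'
    have hYge : X ≤ Y := by
      have h1 := (Nat.lt_floor_add_one X).le
      have h2 : M + 1 ≤ Y := by
        have := Nat.mul_pos hB hC
        have := Nat.le_mul_of_pos_left M hA
        omega
      have h3 : ((M + 1 : ℕ) : ℝ) ≤ Y := by exact_mod_cast h2
      push_cast at h3
      linarith
    have hYle : (Y : ℝ) ≤ (A + B * C) * X := by
      rw [hY]; push_cast
      have h1 : (A : ℝ) * M ≤ A * X := mul_le_mul_of_nonneg_left hMX (by positivity)
      have h2 : (B * C : ℝ) * 1 ≤ B * C * X :=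
        mul_le_mul_of_nonneg_left (by linarith) (by positivity)
      linarith
    have hYN : N0 ≤ Y := by
      have : (N0 : ℝ) ≤ Y := (le_max_left _ _).trans (hbig.trans hYge)
      exact_mod_cast this
    have hlog : Real.log X ≤ Real.log Y := Real.log_le_log (by linarith) hYge
    have hlogY1 : 1 ≤ Real.log Y := by
      rw [Real.le_log_iff_exp_le (by linarith)]
      exact (le_max_right 2 (Real.exp 1)).trans ((le_max_right _ _).trans (hbig.trans hYge))
    have h1 := hN0 Y hYN
    have h2 := primeCounting_bound hlogY1 α hα1
    have h3 : Real.log Y ^ (-α) ≤ Real.log X ^ (-α) :=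
      Real.rpow_le_rpow_of_nonpos hlX hlog (by linarith)
    have h4 : (Y : ℝ) * Real.log Y ^ (-α) ≤ ((A + B * C) * X) * Real.log X ^ (-α) :=
      mul_le_mul hYle h3 (by positivity) (by positivity)
    calc (T.ncard : ℝ) ≤ _ := hcount
      _ ≤ K * Y * Real.log Y ^ (-α) +
          (C + 1) * ((2 * Real.log 4 + 2) * Y * Real.log Y ^ (-α)) :=
        add_le_add h1 (mul_le_mul_of_nonneg_left h2 (by positivity))
      _ = (K + (C + 1) * (2 * Real.log 4 + 2)) * (Y * Real.log Y ^ (-α)) := by ring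
      _ ≤ (K + (C + 1) * (2 * Real.log 4 + 2)) * (((A + B * C) * X) * Real.log X ^ (-α)) :=
        mul_le_mul_of_nonneg_left h4 (by positivity)
      _ = c1 * (X * Real.log X ^ (-α)) := by rw [hc1]; ring
      _ ≤ (c1 + Real.log X0 ^ α + 1) * (X * Real.log X ^ (-α)) := by
        refine mul_le_mul_of_nonneg_right ?_ hpow
        have : 0 ≤ Real.log X0 ^ α := by positivity
        linarith
      _ = _ := by ring
  · have hsub : T ⊆ ((Finset.Ioc 0 ⌊X⌋₊ : Finset ℕ) : Set ℕ) := by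
      intro n hn
      simp only [Finset.coe_Ioc, Set.mem_Ioc]
      exact ⟨hn.1, Nat.le_floor hn.2.1⟩
    have h1 : T.ncard ≤ ⌊X⌋₊ := by
      have := Set.ncard_le_ncard hsub (Finset.finite_toSet _)
      rwa [Set.ncard_coe_finset, Nat.card_Ioc, Nat.sub_zero] at this
    have h2 : (T.ncard : ℝ) ≤ X := le_trans (by exact_mod_cast h1) (Nat.floor_le hX0')
    have h3 : 1 ≤ Real.log X0 ^ α * Real.log X ^ (-α) := by
      have : Real.log X ^ α * Real.log X ^ (-α) = 1 := by
        rw [← Real.rpow_add hlX]; simp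
      rw [← this]
      refine mul_le_mul_of_nonneg_right ?_ (by positivity)
      exact Real.rpow_le_rpow hlX.le
        (Real.log_le_log (by linarith) (not_le.mp hbig).le) hα0
    calc (T.ncard : ℝ) ≤ X * 1 := by linarith
      _ ≤ X * (Real.log X0 ^ α * Real.log X ^ (-α)) := mul_le_mul_of_nonneg_left h3 hX0'
      _ = Real.log X0 ^ α * (X * Real.log X ^ (-α)) := by ring
      _ ≤ (c1 + Real.log X0 ^ α + 1) * (X * Real.log X ^ (-α)) :=
        mul_le_mul_of_nonneg_right (by linarith) hpow
      _ = _ := by ring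
end

section
/- Let A be a positive integer and B an integer with gcd(A, B) = 1. Then there exists a constant c > 0 (depending on A, B) such that for all real X ≥ 2, the number of positive integers n ≤ X such that no prime divisor p of n satisfies p ≡ B (mod A) is at most c·X·(log X)^(−1/φ(A)), where φ is Euler's totient function. -/
open Classical in
/-- Indicator of positive integers without prime factor satisfying `Q`. -/
noncomputable def sieveF (Q : ℕ → Prop) (n : ℕ) : ℝ :=
  if n ≠ 0 ∧ ∀ p : ℕ, p.Prime → p ∣ n → ¬ Q p then 1 else 0

lemma sieveF_nonneg (Q : ℕ → Prop) (n : ℕ) : 0 ≤ sieveF Q n := by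
  unfold sieveF; split_ifs <;> norm_num

lemma sieveF_le_one (Q : ℕ → Prop) (n : ℕ) : sieveF Q n ≤ 1 := by
  unfold sieveF; split_ifs <;> norm_num

lemma sieveF_zero (Q : ℕ → Prop) : sieveF Q 0 = 0 := by
  simp [sieveF]

lemma sieveF_one (Q : ℕ → Prop) : sieveF Q 1 = 1 := by
  unfold sieveF
  rw [if_pos]
  refine ⟨one_ne_zero, fun p hp h => ?_⟩
  exact absurd (Nat.dvd_one.mp h) hp.one_lt.ne'

lemma sieveF_mul (Q : ℕ → Prop) (m n : ℕ) : sieveF Q (m * n) = sieveF Q m * sieveF Q n := by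
  unfold sieveF
  have : (m * n ≠ 0 ∧ ∀ p : ℕ, p.Prime → p ∣ m * n → ¬ Q p) ↔
    (m ≠ 0 ∧ ∀ p : ℕ, p.Prime → p ∣ m → ¬ Q p) ∧ (n ≠ 0 ∧ ∀ p : ℕ, p.Prime → p ∣ n → ¬ Q p) := by
    constructor
    · rintro ⟨h, h2⟩
      exact ⟨⟨left_ne_zero_of_mul h, fun p hp hd => h2 p hp (hd.mul_right _)⟩,
        right_ne_zero_of_mul h, fun p hp hd => h2 p hp (hd.mul_left _)⟩
    · rintro ⟨⟨h1, h2⟩, h3, h4⟩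
      refine ⟨mul_ne_zero h1 h3, fun p hp hd => ?_⟩
      rcases hp.dvd_mul.mp hd with h | h
      · exact h2 p hp h
      · exact h4 p hp h
  by_cases h1 : (m ≠ 0 ∧ ∀ p : ℕ, p.Prime → p ∣ m → ¬ Q p) <;>
  by_cases h2 : (n ≠ 0 ∧ ∀ p : ℕ, p.Prime → p ∣ n → ¬ Q p)
  · rw [if_pos (this.2 ⟨h1, h2⟩), if_pos h1, if_pos h2, one_mul]
  · rw [if_neg (fun h => h2 (this.1 h).2), if_neg h2, mul_zero]
  · rw [if_neg (fun h => h1 (this.1 h).1), if_neg h1, zero_mul]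
  · rw [if_neg (fun h => h1 (this.1 h).1), if_neg h1, zero_mul]

lemma sieveF_prime (Q : ℕ → Prop) [DecidablePred Q] {p : ℕ} (hp : p.Prime) :
    sieveF Q p = if Q p then 0 else 1 := by
  unfold sieveF
  split_ifs with h1 h2 h2
  · exact absurd h2 (h1.2 p hp dvd_rfl)
  · rfl
  · rfl
  · exact absurd ⟨hp.ne_zero, fun r hr hd => by rwa [(Nat.prime_dvd_prime_iff_eq hr hp).1 hd]⟩ h1

open Finset ArithmeticFunction in
lemma sieveF_sum_log (Q : ℕ → Prop) (N : ℕ) :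
    ∑ n ∈ Ioc 0 N, sieveF Q n * Real.log n
      ≤ (Real.log 4 + 4) * N * ∑ n ∈ Ioc 0 N, sieveF Q n / n := by
  let f : ArithmeticFunction ℝ := ⟨sieveF Q, sieveF_zero Q⟩
  let g : ArithmeticFunction ℝ := ⟨fun n => sieveF Q n * vonMangoldt n, by simp⟩
  have hf : ∀ n, f n = sieveF Q n := fun n => rfl
  have hg : ∀ n, g n = sieveF Q n * vonMangoldt n := fun n => rfl
  have h1 : ∀ n, (f * g) n = sieveF Q n * Real.log n := by
    intro n
    rw [mul_apply, ← vonMangoldt_sum, ← Nat.sum_divisorsAntidiagonal' (fun _ d => vonMangoldt d),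
      mul_sum]
    apply sum_congr rfl
    rintro ⟨a, b⟩ hab
    simp only [hf, hg]
    rw [← (Nat.mem_divisorsAntidiagonal.1 hab).1, sieveF_mul, mul_assoc]
  simp_rw [← h1]
  rw [sum_Ioc_mul_eq_sum_sum, mul_sum]
  apply sum_le_sum
  intro n hn
  rw [hf]
  have hn0 : (0:ℝ) < n := by exact_mod_cast (mem_Ioc.1 hn).1
  have h2 : ∑ m ∈ Ioc 0 (N / n), g m ≤ (Real.log 4 + 4) * (N / n) := by
    calc ∑ m ∈ Ioc 0 (N / n), g m ≤ ∑ m ∈ Ioc 0 (N / n), vonMangoldt m := by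
          apply sum_le_sum
          intro m _
          rw [hg]
          exact mul_le_of_le_one_left vonMangoldt_nonneg (sieveF_le_one Q m)
      _ = Chebyshev.psi ((N:ℝ)/n) := by
          unfold Chebyshev.psi
          rw [Nat.floor_div_eq_div]
      _ ≤ _ := Chebyshev.psi_le_const_mul_self (by positivity)
  calc _ ≤ sieveF Q n * ((Real.log 4 + 4) * (N / n)) :=
        mul_le_mul_of_nonneg_left h2 (sieveF_nonneg Q n)
    _ = _ := by ring

open Finset in
lemma sieveF_count (Q : ℕ → Prop) {X : ℝ} (hX : 1 ≤ X) :
    (∑ n ∈ Ioc 0 ⌊X⌋₊, sieveF Q n) * Real.log X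
      ≤ (Real.log 4 + 5) * X * ∑ n ∈ Ioc 0 ⌊X⌋₊, sieveF Q n / n := by
  have h1 := sieveF_sum_log Q ⌊X⌋₊
  have h2 : ∑ n ∈ Ioc 0 ⌊X⌋₊, sieveF Q n * (Real.log X - Real.log n) ≤
      X * ∑ n ∈ Ioc 0 ⌊X⌋₊, sieveF Q n / n := by
    rw [mul_sum]
    apply sum_le_sum
    intro n hn
    have hn0 : (0:ℝ) < n := by exact_mod_cast (mem_Ioc.1 hn).1
    rw [← Real.log_div (by positivity) hn0.ne']
    have : Real.log (X / n) ≤ X / n := by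
      have := Real.log_le_sub_one_of_pos (x := X / n) (by positivity)
      linarith
    calc _ ≤ sieveF Q n * (X / n) := mul_le_mul_of_nonneg_left this (sieveF_nonneg Q n)
      _ = _ := by ring
  have h3 : (Real.log 4 + 4) * (⌊X⌋₊ : ℝ) * ∑ n ∈ Ioc 0 ⌊X⌋₊, sieveF Q n / n ≤
      (Real.log 4 + 4) * X * ∑ n ∈ Ioc 0 ⌊X⌋₊, sieveF Q n / n := by
    have : 0 ≤ Real.log 4 := Real.log_nonneg (by norm_num)
    apply mul_le_mul_of_nonneg_right
    · apply mul_le_mul_of_nonneg_left (Nat.floor_le (by linarith)) (by linarith)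
    · exact sum_nonneg fun n _ => div_nonneg (sieveF_nonneg Q n) (by positivity)
  simp_rw [mul_sub, sum_sub_distrib, ← sum_mul] at h2
  linarith

open Finset in
lemma sieveF_sum_div_le (Q : ℕ → Prop) {X : ℝ} (hX : 1 < X) :
    ∑ n ∈ Ioc 0 ⌊X⌋₊, sieveF Q n / n
      ≤ Real.exp 1 * ∑' n : ℕ, sieveF Q n / (n : ℝ) ^ (1 + 1 / Real.log X) := by
  have hl : 0 < Real.log X := Real.log_pos hX
  have h1 : 1 < 1 + 1 / Real.log X := by
    have : 0 < 1 / Real.log X := by positivity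
    linarith
  have hs : Summable (fun n : ℕ => sieveF Q n / (n : ℝ) ^ (1 + 1 / Real.log X)) := by
    refine Summable.of_nonneg_of_le (fun n => div_nonneg (sieveF_nonneg Q n) (by positivity))
      (fun n => ?_) (Real.summable_one_div_nat_rpow.2 h1)
    exact div_le_div_of_nonneg_right (sieveF_le_one Q n) (by positivity)
  calc _ ≤ ∑ n ∈ Ioc 0 ⌊X⌋₊, Real.exp 1 * (sieveF Q n / (n : ℝ) ^ (1 + 1 / Real.log X)) := by
        apply sum_le_sum
        intro n hn
        have hn0 : (0:ℝ) < n := by exact_mod_cast (mem_Ioc.1 hn).1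
        have hnX : (n:ℝ) ≤ X := (Nat.le_floor_iff (by linarith)).1 (mem_Ioc.1 hn).2
        have h1 : (n:ℝ) ^ (1 / Real.log X) ≤ Real.exp 1 := by
          rw [Real.rpow_def_of_pos hn0]
          apply Real.exp_le_exp.2
          rw [mul_one_div, div_le_one hl]
          exact Real.log_le_log hn0 hnX
        rw [Real.rpow_add hn0, Real.rpow_one, ← mul_div_assoc, div_le_div_iff₀ hn0 (by positivity)]
        have := mul_le_mul_of_nonneg_left h1 (mul_nonneg (sieveF_nonneg Q n) hn0.le)
        nlinarith
    _ = Real.exp 1 * ∑ n ∈ Ioc 0 ⌊X⌋₊, (sieveF Q n / (n : ℝ) ^ (1 + 1 / Real.log X)) := by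
        rw [mul_sum]
    _ ≤ _ := by
        apply mul_le_mul_of_nonneg_left _ (Real.exp_pos 1).le
        exact hs.sum_le_tsum _ (fun n _ => div_nonneg (sieveF_nonneg Q n) (by positivity))

lemma zeta_bound {s : ℝ} (hs : 1 < s) : ∑' n : ℕ, 1 / (n : ℝ) ^ s ≤ s / (s - 1) := by
  have h := ZetaAsymptotics.termTSum_of_lt hs
  have h0 : 0 ≤ ZetaAsymptotics.termTSum s := tsum_nonneg fun n => ZetaAsymptotics.term_nonneg _ _
  rw [(Real.summable_one_div_nat_rpow.2 hs).tsum_eq_zero_add]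
  push_cast
  rw [Real.zero_rpow (by linarith), div_zero, zero_add]
  rw [h] at h0
  have hs0 : 0 < s := by linarith
  have : 1 / s * ∑' n : ℕ, 1 / (n + 1 : ℝ) ^ s ≤ 1 / (s - 1) := by linarith
  calc _ = s * (1 / s * ∑' n : ℕ, 1 / (n + 1 : ℝ) ^ s) := by field_simp
    _ ≤ s * (1 / (s - 1)) := mul_le_mul_of_nonneg_left this hs0.le
    _ = _ := by ring

open Finset Filter Topology in
lemma euler_bound (Q : ℕ → Prop) [DecidablePred Q] {s : ℝ} (hs : 1 < s) :
    ∑' n : ℕ, sieveF Q n / (n : ℝ) ^ s ≤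
      (∑' n : ℕ, 1 / (n : ℝ) ^ s) *
        Real.exp (-∑' n : ℕ, (if n.Prime ∧ Q n then (1:ℝ) else 0) / (n : ℝ) ^ s) := by
  have hs0 : s ≠ 0 := by linarith
  let z : ℕ →*₀ ℝ :=
    { toFun := fun n => 1 / (n : ℝ) ^ s
      map_zero' := by simp [Real.zero_rpow hs0]
      map_one' := by simp
      map_mul' := fun m n => by
        push_cast
        rw [Real.mul_rpow (by positivity) (by positivity), one_div_mul_one_div] }
  let f : ℕ →*₀ ℝ :=
    { toFun := fun n => sieveF Q n / (n : ℝ) ^ s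
      map_zero' := by simp [sieveF_zero]
      map_one' := by simp [sieveF_one]
      map_mul' := fun m n => by
        push_cast
        rw [Real.mul_rpow (by positivity) (by positivity), sieveF_mul, div_mul_div_comm] }
  have hz : ∀ n, z n = 1 / (n : ℝ) ^ s := fun n => rfl
  have hf : ∀ n, f n = sieveF Q n / (n : ℝ) ^ s := fun n => rfl
  have hz0 : ∀ n, 0 ≤ z n := fun n => by rw [hz]; positivity
  have hf0 : ∀ n, 0 ≤ f n := fun n => div_nonneg (sieveF_nonneg Q n) (by positivity)
  have hzs : Summable z := Real.summable_one_div_nat_rpow.2 hs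
  have hfz : ∀ n, f n ≤ z n := fun n =>
    div_le_div_of_nonneg_right (sieveF_le_one Q n) (by positivity)
  have hfs : Summable f := Summable.of_nonneg_of_le hf0 hfz hzs
  let w : ℕ → ℝ := fun n => (if n.Prime ∧ Q n then (1:ℝ) else 0) / (n : ℝ) ^ s
  have hw0 : ∀ n, 0 ≤ w n := fun n => by
    simp only [w]; split_ifs <;> positivity
  have hwz : ∀ n, w n ≤ z n := fun n => by
    apply div_le_div_of_nonneg_right _ (by positivity)
    split_ifs <;> norm_num
  have hws : Summable w := Summable.of_nonneg_of_le hw0 hwz hzs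
  have h1 := EulerProduct.eulerProduct_completely_multiplicative (f := z) (by simpa using hzs.norm)
  have h2 := EulerProduct.eulerProduct_completely_multiplicative (f := f) (by simpa using hfs.norm)
  have h3 : Tendsto (fun n : ℕ => Real.exp (-∑ i ∈ range n, w i)) atTop
      (𝓝 (Real.exp (-∑' n, w n))) :=
    (Real.continuous_exp.tendsto _).comp (hws.hasSum.tendsto_sum_nat.neg)
  refine le_of_tendsto_of_tendsto' h2 (h1.mul h3) (fun N => ?_)
  have h4 : ∑ i ∈ range N, w i = ∑ i ∈ N.primesBelow, w i := by
    symm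
    apply sum_subset
    · intro p hp; exact mem_range.2 (Nat.lt_of_mem_primesBelow hp)
    · intro p hp hp'
      have : ¬ p.Prime := fun h => hp' (Nat.mem_primesBelow.2 ⟨mem_range.1 hp, h⟩)
      simp [w, this]
  rw [h4, ← sum_neg_distrib, Real.exp_sum, ← prod_mul_distrib]
  apply Finset.prod_le_prod
  · intro p hp
    have hp' := Nat.prime_of_mem_primesBelow hp
    have : z p < 1 := by
      rw [hz, div_lt_one (by have := hp'.pos; positivity)]
      exact Real.one_lt_rpow (by exact_mod_cast hp'.one_lt) (by linarith)
    have := hfz p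
    apply inv_nonneg.2; linarith
  · intro p hp
    have hp' := Nat.prime_of_mem_primesBelow hp
    have hz1 : z p < 1 := by
      rw [hz, div_lt_one (by have := hp'.pos; positivity)]
      exact Real.one_lt_rpow (by exact_mod_cast hp'.one_lt) (by linarith)
    by_cases hQ : Q p
    · have e1 : f p = 0 := by rw [hf, sieveF_prime Q hp', if_pos hQ, zero_div]
      have e2 : w p = z p := by simp [w, hp', hQ, hz]
      rw [e1, e2, sub_zero, inv_one, inv_mul_eq_div, le_div_iff₀ (by linarith), one_mul]
      have := Real.add_one_le_exp (-z p)
      linarith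
    · have e1 : f p = z p := by rw [hf, sieveF_prime Q hp', if_neg hQ, hz]
      have e2 : w p = 0 := by simp [w, hQ]
      rw [e1, e2]; simp

lemma lseries_real (v : ℕ → ℝ) (hv : v 0 = 0) (x : ℝ) :
    LSeries (fun n => (v n : ℂ)) (x : ℂ) = ((∑' n : ℕ, v n / (n : ℝ) ^ x : ℝ) : ℂ) := by
  rw [LSeries, Complex.ofReal_tsum]
  refine tsum_congr fun n => ?_
  rw [LSeries.term]
  split_ifs with hn
  · simp [hn, hv]
  · push_cast [Complex.ofReal_cpow (Nat.cast_nonneg n)]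
    rfl

open ArithmeticFunction in
lemma prime_log_lower (q : ℕ) [NeZero q] (a : ZMod q) (ha : IsUnit a) :
    ∃ C : ℝ, ∀ x ∈ Set.Ioc (1 : ℝ) 2, (q.totient : ℝ)⁻¹ / (x - 1) - C ≤
      ∑' n : ℕ, (Real.log n * if n.Prime ∧ (n : ZMod q) = a then (1 : ℝ) else 0) / (n : ℝ) ^ x := by
  obtain ⟨C, hC⟩ := vonMangoldt.LSeries_residueClass_lower_bound ha
  have hnp := vonMangoldt.summable_residueClass_non_primes_div a
  refine ⟨C + ∑' n : ℕ, (if n.Prime then 0 else vonMangoldt.residueClass a n) / n, fun x hx => ?_⟩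
  have h := hC hx
  have hx1 : 1 < x := hx.1
  have hle : ∀ n : ℕ, (if n.Prime then 0 else vonMangoldt.residueClass a n) / (n : ℝ) ^ x ≤
      (if n.Prime then 0 else vonMangoldt.residueClass a n) / n := by
    intro n
    rcases Nat.eq_zero_or_pos n with rfl | hn
    · simp
    · have hn1 : (1 : ℝ) ≤ n := by exact_mod_cast hn
      apply div_le_div_of_nonneg_left _ (by linarith)
      · exact Real.self_le_rpow_of_one_le hn1 hx1.le
      · split_ifs
        · exact le_rfl
        · exact vonMangoldt.residueClass_nonneg a n
  have h0 : ∀ n : ℕ, 0 ≤ (if n.Prime then 0 else vonMangoldt.residueClass a n) / (n : ℝ) ^ x := by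
    intro n
    apply div_nonneg _ (by positivity)
    split_ifs
    · exact le_rfl
    · exact vonMangoldt.residueClass_nonneg a n
  have hs2 := Summable.of_nonneg_of_le h0 hle hnp
  have hs1 : Summable (fun n : ℕ => vonMangoldt.residueClass a n / (n : ℝ) ^ x) := by
    have h1 : LSeriesSummable (fun n => (vonMangoldt.residueClass a n : ℂ)) (x : ℂ) :=
      LSeriesSummable_of_abscissaOfAbsConv_lt_re <|
        (vonMangoldt.abscissaOfAbsConv_residueClass_le_one a).trans_lt <| by
          simp only [Complex.ofReal_re]; exact_mod_cast hx1
    rw [LSeriesSummable] at h1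
    rw [← Complex.summable_ofReal]
    refine h1.congr fun n => ?_
    rw [LSeries.term]
    split_ifs with hn
    · simp [hn]
    · push_cast [Complex.ofReal_cpow (Nat.cast_nonneg n)]
      rfl
  have heq : ∀ n : ℕ, (Real.log n * if n.Prime ∧ (n : ZMod q) = a then (1 : ℝ) else 0) / (n : ℝ) ^ x
      = vonMangoldt.residueClass a n / (n : ℝ) ^ x -
        (if n.Prime then 0 else vonMangoldt.residueClass a n) / (n : ℝ) ^ x := by
    intro n
    rw [← sub_div]
    congr 1
    by_cases hp : n.Prime
    · by_cases hq : (n : ZMod q) = a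
      · simp [hp, hq, vonMangoldt.residueClass, vonMangoldt_apply_prime hp]
      · simp [hp, hq, vonMangoldt.residueClass]
    · simp [hp]
  rw [tsum_congr heq, hs1.tsum_sub hs2]
  have := hs2.tsum_le_tsum hle hnp
  linarith

lemma prime_lower (q : ℕ) [NeZero q] (a : ZMod q) (ha : IsUnit a) :
    ∃ C : ℝ, ∀ x ∈ Set.Ioc (1 : ℝ) 2, -((q.totient : ℝ)⁻¹ * Real.log (x - 1)) - C ≤
      ∑' n : ℕ, (if n.Prime ∧ (n : ZMod q) = a then (1 : ℝ) else 0) / (n : ℝ) ^ x := by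
  obtain ⟨C, hC⟩ := prime_log_lower q a ha
  set w : ℕ → ℝ := fun n => if n.Prime ∧ (n : ZMod q) = a then (1 : ℝ) else 0 with hw
  have hw0 : w 0 = 0 := by simp [hw, Nat.not_prime_zero]
  have hwn : ∀ n, 0 ≤ w n := fun n => by simp only [hw]; split_ifs <;> norm_num
  have hwl : ∀ n, w n ≤ 1 := fun n => by simp only [hw]; split_ifs <;> norm_num
  have habs : LSeries.abscissaOfAbsConv (fun n => (w n : ℂ)) ≤ 1 := by
    apply LSeries.abscissaOfAbsConv_le_of_le_const
    refine ⟨1, fun n _ => ?_⟩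
    rw [Complex.norm_real, Real.norm_of_nonneg (hwn n)]
    exact hwl n
  have hder : ∀ x : ℝ, 1 < x → HasDerivAt (fun y : ℝ => ∑' n : ℕ, w n / (n : ℝ) ^ y)
      (-∑' n : ℕ, (Real.log n * w n) / (n : ℝ) ^ x) x := by
    intro x hx
    have h1 := LSeries_hasDerivAt (f := fun n => (w n : ℂ)) (s := (x : ℂ))
      (habs.trans_lt (by simp only [Complex.ofReal_re]; exact_mod_cast hx))
    have h2 := h1.real_of_complex
    have e : LSeries.logMul (fun n => (w n : ℂ)) = fun n : ℕ => ((Real.log n * w n : ℝ) : ℂ) := by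
      funext n
      simp [LSeries.logMul, Complex.natCast_log]
    rw [e, lseries_real _ (by simp)] at h2
    simp only [lseries_real w hw0, Complex.ofReal_re, Complex.neg_re] at h2
    exact h2
  refine ⟨2 * |C|, fun x hx => ?_⟩
  have hder2 : ∀ y ∈ Set.Icc x 2, HasDerivAt
      (fun y : ℝ => (∑' n : ℕ, w n / (n : ℝ) ^ y) + (q.totient : ℝ)⁻¹ * Real.log (y - 1) - C * y)
      (-(∑' n : ℕ, (Real.log n * w n) / (n : ℝ) ^ y) + (q.totient : ℝ)⁻¹ * (1 / (y - 1)) - C * 1)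
      y := by
    intro y hy
    have hy1 : 1 < y := lt_of_lt_of_le hx.1 hy.1
    refine ((hder y hy1).add ?_).sub ((hasDerivAt_id y).const_mul C)
    exact (((hasDerivAt_id y).sub_const 1).log (by simp only [id]; linarith)).const_mul _
  have hanti := antitoneOn_of_hasDerivWithinAt_nonpos (convex_Icc x 2)
    (fun y hy => (hder2 y hy).continuousAt.continuousWithinAt)
    (fun y hy => (hder2 y (interior_subset hy)).hasDerivWithinAt)
    (fun y hy => by
      have hy' := interior_subset hy
      have := hC y ⟨lt_of_lt_of_le hx.1 hy'.1, hy'.2⟩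
      rw [mul_one_div]
      linarith)
  have h3 := hanti (Set.left_mem_Icc.2 hx.2) (Set.right_mem_Icc.2 hx.2) hx.2
  simp only at h3
  have h4 : 0 ≤ ∑' n : ℕ, w n / (n : ℝ) ^ (2 : ℝ) :=
    tsum_nonneg fun n => div_nonneg (hwn n) (by positivity)
  have h5 : Real.log (2 - 1) = 0 := by norm_num
  rw [h5] at h3
  have h6 : C * (2 - x) ≤ 2 * |C| := by
    have h7 : C * (2 - x) ≤ |C| * (2 - x) :=
      mul_le_mul_of_nonneg_right (le_abs_self C) (by linarith [hx.2])
    have h8 : |C| * (2 - x) ≤ |C| * 2 :=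
      mul_le_mul_of_nonneg_left (by linarith [hx.1]) (abs_nonneg C)
    linarith
  linarith

/-- Sieve bound: for `A > 0` and `B` with `gcd(A,B) = 1`, the number of positive
integers `n ≤ X` having no prime factor `p ≡ B (mod A)` is
`≤ c·X·(log X)^(−1/φ(A))`. -/
theorem sieve_no_prime_factor_in_class (A : ℕ) (hA : 0 < A) (B : ℤ)
    (hAB : Int.gcd (A : ℤ) B = 1) :
    ∃ c : ℝ, 0 < c ∧ ∀ X : ℝ, 2 ≤ X →
      ({n : ℕ | 0 < n ∧ (n : ℝ) ≤ X ∧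
          ∀ p : ℕ, p.Prime → p ∣ n → ¬((p : ℤ) ≡ B [ZMOD (A : ℤ)])}.ncard : ℝ)
        ≤ c * X * Real.log X ^ (-(1 / (A.totient : ℝ))) := by
  have : NeZero A := ⟨hA.ne'⟩
  have hu : IsUnit (B : ZMod A) := by
    rw [ZMod.coe_int_isUnit_iff_isCoprime]
    exact Int.isCoprime_iff_gcd_eq_one.2 hAB
  obtain ⟨C, hC⟩ := prime_lower A (B : ZMod A) hu
  set Q : ℕ → Prop := fun n => (n : ZMod A) = (B : ZMod A) with hQ
  have hQiff : ∀ p : ℕ, ((p : ℤ) ≡ B [ZMOD (A : ℤ)]) ↔ Q p := by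
    intro p
    rw [← ZMod.intCast_eq_intCast_iff]
    simp [hQ]
  have hcount : ∀ X : ℝ, 2 ≤ X → ({n : ℕ | 0 < n ∧ (n : ℝ) ≤ X ∧
      ∀ p : ℕ, p.Prime → p ∣ n → ¬((p : ℤ) ≡ B [ZMOD (A : ℤ)])}.ncard : ℝ) =
      ∑ n ∈ Finset.Ioc 0 ⌊X⌋₊, sieveF Q n := by
    intro X hX
    classical
    have e : {n : ℕ | 0 < n ∧ (n : ℝ) ≤ X ∧
      ∀ p : ℕ, p.Prime → p ∣ n → ¬((p : ℤ) ≡ B [ZMOD (A : ℤ)])} =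
      ((Finset.Ioc 0 ⌊X⌋₊).filter
        (fun n => n ≠ 0 ∧ ∀ p : ℕ, p.Prime → p ∣ n → ¬ Q p) : Finset ℕ) := by
      ext n
      simp only [hQiff, Set.mem_ofPred_eq, Finset.coe_filter, Finset.mem_Ioc,
        Nat.le_floor_iff (show 0 ≤ X by linarith)]
      constructor
      · rintro ⟨h1, h2, h3⟩; exact ⟨⟨h1, h2⟩, h1.ne', h3⟩
      · rintro ⟨⟨h1, h2⟩, _, h3⟩; exact ⟨h1, h2, h3⟩
    rw [e, Set.ncard_coe_finset, Finset.card_filter]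
    push_cast
    refine Finset.sum_congr rfl fun n _ => ?_
    unfold sieveF
    congr 1
  have hφ : (0 : ℝ) < (A.totient : ℝ)⁻¹ := by
    have := Nat.totient_pos.2 hA
    positivity
  have hl4 : 0 ≤ Real.log 4 := Real.log_nonneg (by norm_num)
  set K : ℝ := (Real.log 4 + 5) * (Real.exp 1 * (2 * Real.exp C)) with hK
  have hK0 : 0 < K := by positivity
  refine ⟨K + 1, by linarith, fun X hX => ?_⟩
  rw [hcount X hX, one_div]
  have hlog : 0 < Real.log X := Real.log_pos (by linarith)
  by_cases hlX : Real.log X < 1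
  · have h1 : (1 : ℝ) ≤ Real.log X ^ (-(A.totient : ℝ)⁻¹) :=
      Real.one_le_rpow_of_pos_of_le_one_of_nonpos hlog hlX.le (by linarith)
    have h2 : ∑ n ∈ Finset.Ioc 0 ⌊X⌋₊, sieveF Q n ≤ X := by
      calc _ ≤ ∑ n ∈ Finset.Ioc 0 ⌊X⌋₊, (1 : ℝ) :=
            Finset.sum_le_sum fun n _ => sieveF_le_one Q n
        _ = ⌊X⌋₊ := by simp
        _ ≤ X := Nat.floor_le (by linarith)
    have h3 : X ≤ (K + 1) * X := by nlinarith
    calc _ ≤ (K + 1) * X * 1 := by linarith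
      _ ≤ _ := mul_le_mul_of_nonneg_left h1 (by nlinarith)
  · push Not at hlX
    set s : ℝ := 1 + 1 / Real.log X with hs
    have hs1 : s - 1 = 1 / Real.log X := by rw [hs]; ring
    have hpos : 0 < 1 / Real.log X := by positivity
    have hs2 : 1 < s := by linarith
    have hs3 : s ≤ 2 := by
      have : 1 / Real.log X ≤ 1 := (div_le_one hlog).2 hlX
      linarith
    have a1 := sieveF_count Q (X := X) (by linarith)
    have a2 := sieveF_sum_div_le Q (X := X) (by linarith)
    have a3 := euler_bound Q hs2
    have a4 := zeta_bound hs2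
    have a5 := hC s ⟨hs2, hs3⟩
    rw [← hs] at a2
    have a6 : Real.exp (-∑' n : ℕ, (if n.Prime ∧ Q n then (1:ℝ) else 0) / (n : ℝ) ^ s) ≤
        Real.exp C * Real.log X ^ (-(A.totient : ℝ)⁻¹) := by
      rw [Real.rpow_def_of_pos hlog, ← Real.exp_add]
      apply Real.exp_le_exp.2
      rw [hs1, one_div, Real.log_inv] at a5
      linarith
    have a7 : s / (s - 1) ≤ 2 * Real.log X := by
      rw [hs1, div_div_eq_mul_div, div_one]
      exact mul_le_mul_of_nonneg_right hs3 hlog.le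
    have a8 : ∑' n : ℕ, sieveF Q n / (n : ℝ) ^ s ≤
        2 * Real.log X * (Real.exp C * Real.log X ^ (-(A.totient : ℝ)⁻¹)) :=
      a3.trans (mul_le_mul (a4.trans a7) a6 (Real.exp_pos _).le (by positivity))
    set T : ℝ := Real.log X ^ (-(A.totient : ℝ)⁻¹) with hT
    have hT0 : 0 < T := Real.rpow_pos_of_pos hlog _
    have a9 : (∑ n ∈ Finset.Ioc 0 ⌊X⌋₊, sieveF Q n) * Real.log X ≤ (K * X * T) * Real.log X := by
      refine a1.trans ?_
      calc _ ≤ (Real.log 4 + 5) * X * (Real.exp 1 * (2 * Real.log X * (Real.exp C * T))) := by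
            apply mul_le_mul_of_nonneg_left _ (by positivity)
            exact a2.trans (mul_le_mul_of_nonneg_left a8 (Real.exp_pos 1).le)
        _ = _ := by rw [hK]; ring
    have a10 := le_of_mul_le_mul_right a9 hlog
    have : 0 ≤ X * T := by positivity
    linarith
end

section
/- For every g in Λ, both components of the vector g·(3,5)ᵗ are positive, and the Jacobi symbol (a/b) equals −1, where (a, b)ᵗ = g·(3,5)ᵗ. -/
/-- The monoid `Λ` generated by `[[1,4],[0,1]]` and `[[1,0],[4,1]]`. -/
def Lambda : Submonoid (Matrix (Fin 2) (Fin 2) ℤ) :=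
  Submonoid.closure {!![1, 4; 0, 1], !![1, 0; 4, 1]}

theorem orbit_aux (g : Matrix (Fin 2) (Fin 2) ℤ) (hg : g ∈ Lambda) :
    ∃ a b : ℕ, 0 < a ∧ Odd b ∧ g.mulVec ![3, 5] = ![(a : ℤ), (b : ℤ)] ∧
      jacobiSym (a : ℤ) b = -1 := by
  unfold Lambda at hg
  induction hg using Submonoid.closure_induction_left with
  | one =>
    refine ⟨3, 5, by norm_num, by decide, by simp, by norm_num⟩
  | mul_left x hx y hy ih =>
    obtain ⟨a, b, ha, hb, hv, hj⟩ := ih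
    rcases hx with rfl | rfl
    · refine ⟨a + 4 * b, b, by omega, hb, ?_, ?_⟩
      · rw [← Matrix.mulVec_mulVec, hv]
        ext i; fin_cases i <;> simp [Matrix.mulVec, dotProduct]
      · rw [← hj]
        apply jacobiSym.mod_left'
        push_cast
        simp
    · refine ⟨a, b + 4 * a, ha, ?_, ?_, ?_⟩
      · obtain ⟨k, rfl⟩ := hb
        exact ⟨k + 2 * a, by ring⟩
      · rw [← Matrix.mulVec_mulVec, hv]
        ext i; fin_cases i <;> simp [Matrix.mulVec, dotProduct] ; try ring
      · have hb' : Odd (b + 4 * a) := by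
          obtain ⟨k, rfl⟩ := hb
          exact ⟨k + 2 * a, by ring⟩
        rw [jacobiSym.mod_right' a hb', Nat.add_mod_right, ← jacobiSym.mod_right' a hb, hj]

/-- For every `g ∈ Λ`, the vector `g·(3,5)ᵗ = (a,b)ᵗ` has positive entries, and
the Jacobi symbol `(a/b)` equals `−1`. -/
theorem jacobi_symbol_on_orbit (g : Matrix (Fin 2) (Fin 2) ℤ) (hg : g ∈ Lambda) :
    0 < g.mulVec ![3, 5] 0 ∧ 0 < g.mulVec ![3, 5] 1 ∧
      jacobiSym (g.mulVec ![3, 5] 0) (g.mulVec ![3, 5] 1).toNat = -1 := by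
  obtain ⟨a, b, ha, hb, hv, hj⟩ := orbit_aux g hg
  rw [hv]
  have := hb.pos
  simpa using ⟨ha, this, hj⟩
end

section
/- For every g in Λ, neither component of the vector g·(3,5)ᵗ is a perfect square. -/
lemma orbit_invariant (g : Matrix (Fin 2) (Fin 2) ℤ) (hg : g ∈ Lambda) :
    ∃ a b : ℕ, g.mulVec ![3, 5] = ![(a : ℤ), (b : ℤ)] ∧ a % 4 = 3 ∧ b % 4 = 1 ∧
      jacobiSym a b = -1 := by
  unfold Lambda at hg
  induction hg using Submonoid.closure_induction_left with
  | one => exact ⟨3, 5, by simp, by norm_num, by norm_num, by norm_num⟩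
  | mul_left x hx y hy ih =>
    obtain ⟨a, b, h, ha, hb, hJ⟩ := ih
    rw [← Matrix.mulVec_mulVec, h]
    rcases hx with rfl | rfl
    · refine ⟨a + 4 * b, b, ?_, by omega, hb, ?_⟩
      · ext i; fin_cases i <;> simp [Matrix.mulVec, dotProduct]
      · rw [← hJ]
        apply jacobiSym.mod_left'
        push_cast
        simp
    · refine ⟨a, b + 4 * a, ?_, ha, by omega, ?_⟩
      · ext i; fin_cases i <;> simp [Matrix.mulVec, dotProduct, add_comm]
      · rw [← hJ, jacobiSym.mod_right' a (b := b + 4 * a) (Nat.odd_iff.2 (by omega)),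
          jacobiSym.mod_right' a (b := b) (Nat.odd_iff.2 (by omega)), Nat.add_mod_right]

/-- For every `g ∈ Λ`, neither component of `g·(3,5)ᵗ` is a perfect square. -/
theorem no_squares_on_orbit (g : Matrix (Fin 2) (Fin 2) ℤ) (hg : g ∈ Lambda) :
    ¬ IsSquare (g.mulVec ![3, 5] 0) ∧ ¬ IsSquare (g.mulVec ![3, 5] 1) := by
  obtain ⟨a, b, h, ha, hb, hJ⟩ := orbit_invariant g hg
  rw [h]
  constructor
  · rintro ⟨r, hr⟩
    have hr : (a : ℤ) = r * r := hr
    have h4 : (r * r) % 4 = 3 := by omega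
    have : r % 4 = 0 ∨ r % 4 = 1 ∨ r % 4 = 2 ∨ r % 4 = 3 := by omega
    rcases this with h | h | h | h <;> simp [Int.mul_emod, h] at h4
  · rintro ⟨r, hr⟩
    have hr : (b : ℤ) = r * r := hr
    have hb2 : b = r.natAbs ^ 2 := by
      have := congrArg Int.natAbs hr
      rw [Int.natAbs_mul, Int.natAbs_natCast] at this
      rw [this, sq]
    rw [hb2, jacobiSym.pow_right] at hJ
    nlinarith [sq_nonneg (jacobiSym a r.natAbs)]
end

section
/- The set S = { 80·x·y + 12·x + 5 : x, y positive integers } has density one in the residue class 1 mod 4; that is, (1/X)·#{ n ≤ X : n ≡ 1 (mod 4) and n ∉ S } tends to 0 as X → ∞. -/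
open ArithmeticFunction in
/-- The reciprocals of the primes in an invertible residue class are not summable. -/
lemma aux_not_summable {q : ℕ} [NeZero q] {a : ZMod q} (ha : IsUnit a) :
    ¬ Summable fun n : ℕ ↦ if n.Prime ∧ (n : ZMod q) = a then (1 : ℝ) / n else 0 := by
  intro hg
  set g : ℕ → ℝ := fun n : ℕ ↦ if n.Prime ∧ (n : ZMod q) = a then (1 : ℝ) / n else 0 with hgdef
  have hg0 : ∀ n, 0 ≤ g n := by
    intro n; simp only [hgdef]; split_ifs <;> positivity
  obtain ⟨C, hC⟩ := vonMangoldt.LSeries_residueClass_lower_bound ha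
  set c : ℝ := (q.totient : ℝ)⁻¹ with hc
  have hcpos : 0 < c := inv_pos.mpr (mod_cast q.totient.pos_of_neZero)
  obtain ⟨s, hs⟩ : ∃ s : Finset ℕ, ∑' n, g n - ∑ n ∈ s, g n < c / 2 := by
    have h1 := hg.hasSum.eventually (lt_mem_nhds (show ∑' n, g n - c / 2 < ∑' n, g n by linarith))
    obtain ⟨s, hs⟩ := h1.exists
    exact ⟨s, by linarith⟩
  set A : ℕ → ℝ := fun n ↦ (if n.Prime then 0 else vonMangoldt.residueClass a n) / n with hA
  have hAs : Summable A := vonMangoldt.summable_residueClass_non_primes_div a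
  set B : ℕ → ℝ := fun n ↦ if n ∈ s then vonMangoldt.residueClass a n / n else 0 with hB
  have hBs : Summable B :=
    summable_of_ne_finset_zero (s := s) (fun n hn ↦ by simp [hB, hn])
  set h : ℕ → ℝ := fun n ↦ if n ∈ s then g n else 0 with hh
  have hhs : Summable h :=
    summable_of_ne_finset_zero (s := s) (fun n hn ↦ by simp [hh, hn])
  have hht : ∑' n, h n = ∑ n ∈ s, g n := by
    rw [tsum_eq_sum (s := s) (fun n hn ↦ by simp [hh, hn])]
    exact Finset.sum_congr rfl fun n hn ↦ by simp [hh, hn]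
  have hgh : ∑' n, (g n - h n) < c / 2 := by
    rw [hg.tsum_sub hhs, hht]; exact hs
  have hterm : ∀ ε : ℝ, 0 < ε → ∀ n : ℕ, vonMangoldt.residueClass a n / (n : ℝ) ^ (1 + ε) ≤
      A n + B n + ε⁻¹ * (g n - h n) := by
    intro ε hε n
    rcases n.eq_zero_or_pos with rfl | hn
    · simp [hA, hB, hgdef, hh]
    have hn1 : (1 : ℝ) ≤ n := by exact_mod_cast hn
    have hn0 : (0 : ℝ) < n := by linarith
    have hr := vonMangoldt.residueClass_nonneg a n
    have hle : vonMangoldt.residueClass a n / (n : ℝ) ^ (1 + ε) ≤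
        vonMangoldt.residueClass a n / n := by
      refine div_le_div_of_nonneg_left hr hn0 ?_
      conv_lhs => rw [← Real.rpow_one n]
      exact Real.rpow_le_rpow_of_exponent_le hn1 (by linarith)
    have hrn : 0 ≤ vonMangoldt.residueClass a n / n := div_nonneg hr hn0.le
    have hA0 : 0 ≤ A n := by
      simp only [hA]; split_ifs
      · simp
      · exact hrn
    by_cases hns : n ∈ s
    · simp only [hB, hh, hns, if_true, sub_self, mul_zero]
      linarith
    · simp only [hB, hh, hns, if_false, sub_zero, add_zero]
      by_cases hp : n.Prime
      · by_cases hna : (n : ZMod q) = a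
        · have h1 : vonMangoldt.residueClass a n = Real.log n := by
            simp [vonMangoldt.residueClass, Set.indicator, hna, vonMangoldt_apply_prime hp]
          have h2 : g n = 1 / n := by simp [hgdef, hp, hna]
          have h3 := Real.log_le_rpow_div hn0.le hε
          rw [h1, h2, Real.rpow_add hn0, Real.rpow_one]
          have hpow : 0 < (n : ℝ) ^ ε := Real.rpow_pos_of_pos hn0 _
          have : Real.log n / (n * (n : ℝ) ^ ε) ≤ ε⁻¹ * (1 / n) := by
            rw [div_le_iff₀ (by positivity)]
            calc Real.log n ≤ (n : ℝ) ^ ε / ε := h3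
              _ = ε⁻¹ * (1 / n) * (n * (n : ℝ) ^ ε) := by field_simp
          linarith
        · have h1 : vonMangoldt.residueClass a n = 0 := by
            simp [vonMangoldt.residueClass, Set.indicator, hna]
          have := hg0 n
          rw [h1, zero_div]
          positivity
      · have h1 : A n = vonMangoldt.residueClass a n / n := by simp [hA, hp]
        have : 0 ≤ ε⁻¹ * g n := mul_nonneg (by positivity) (hg0 n)
        linarith
  have hmain : ∀ ε : ℝ, 0 < ε → ε ≤ 1 →
      c / ε - C ≤ ∑' n, A n + ∑' n, B n + ε⁻¹ * (c / 2) := by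
    intro ε hε hε1
    have h1 := hC (x := 1 + ε) ⟨by linarith, by linarith⟩
    rw [add_sub_cancel_left] at h1
    have hsum : Summable fun n : ℕ ↦ vonMangoldt.residueClass a n / (n : ℝ) ^ (1 + ε) :=
      LSeries.summable_real_of_abscissaOfAbsConv_lt <|
        (vonMangoldt.abscissaOfAbsConv_residueClass_le_one a).trans_lt <| by
          exact_mod_cast (by linarith : (1 : ℝ) < 1 + ε)
    have hgs := (hg.sub hhs).mul_left ε⁻¹
    have h2 := hsum.tsum_le_tsum (hterm ε hε) ((hAs.add hBs).add hgs)
    rw [(hAs.add hBs).tsum_add hgs, hAs.tsum_add hBs, tsum_mul_left] at h2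
    have h3 : ε⁻¹ * ∑' n, (g n - h n) ≤ ε⁻¹ * (c / 2) :=
      mul_le_mul_of_nonneg_left hgh.le (by positivity)
    linarith
  set K : ℝ := |∑' n, A n + ∑' n, B n + C| + c with hK
  have hKpos : 0 < K := by positivity
  have h1 := hmain (c / (4 * K)) (by positivity) (by
    rw [div_le_one (by positivity)]
    have := abs_nonneg (∑' n, A n + ∑' n, B n + C)
    linarith)
  have h2 : c / (c / (4 * K)) = 4 * K := by field_simp
  have h3 : (c / (4 * K))⁻¹ * (c / 2) = 2 * K := by field_simp; norm_num
  rw [h2, h3] at h1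
  have h4 := le_abs_self (∑' n, A n + ∑' n, B n + C)
  linarith

lemma aux_totient (s : Finset ℕ) (hs : ∀ p ∈ s, p.Prime) :
    ((∏ p ∈ s, p).totient : ℝ) / ((∏ p ∈ s, p : ℕ) : ℝ) ≤
      Real.exp (-∑ p ∈ s, (1 : ℝ) / p) := by
  have h0 : (∏ p ∈ s, p) ≠ 0 := Finset.prod_ne_zero_iff.mpr fun p hp ↦ (hs p hp).ne_zero
  have h1 := Nat.totient_eq_mul_prod_factors (∏ p ∈ s, p)
  rw [Nat.primeFactors_prod hs] at h1
  have h2 : ((∏ p ∈ s, p).totient : ℝ) =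
      ((∏ p ∈ s, p : ℕ) : ℝ) * ∏ p ∈ s, (1 - (p : ℝ)⁻¹) := by
    have := congrArg (fun x : ℚ ↦ (x : ℝ)) h1
    push_cast at this ⊢
    exact this
  have h0' : ((∏ p ∈ s, p : ℕ) : ℝ) ≠ 0 := by exact_mod_cast h0
  rw [h2, mul_div_cancel_left₀ _ h0', ← Finset.sum_neg_distrib, Real.exp_sum]
  refine Finset.prod_le_prod (fun p hp ↦ ?_) (fun p hp ↦ ?_)
  · have : (1 : ℝ) ≤ p := by exact_mod_cast (hs p hp).one_le
    have := inv_le_one_of_one_le₀ this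
    linarith
  · rw [one_div]; exact Real.one_sub_le_exp_neg _

lemma aux_exists (ε : ℝ) (hε : 0 < ε) : ∃ N : ℕ, N ≠ 0 ∧
    (∀ p : ℕ, p.Prime → p ∣ N → p % 20 = 3 ∧ 23 ≤ p) ∧ (N.totient : ℝ) / N < ε := by
  have ha : IsUnit (3 : ZMod 20) := by decide
  have hns := aux_not_summable ha
  set g : ℕ → ℝ := fun n : ℕ ↦ if n.Prime ∧ (n : ZMod 20) = 3 then (1 : ℝ) / n else 0 with hgdef
  have hg0 : ∀ n, 0 ≤ g n := by
    intro n; simp only [hgdef]; split_ifs <;> positivity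
  obtain ⟨u, hu⟩ : ∃ u : Finset ℕ, 1 - Real.log ε + 1 < ∑ n ∈ u, g n := by
    by_contra! hcon
    exact hns (summable_of_sum_le hg0 hcon)
  set s := u.filter (fun n : ℕ ↦ (n.Prime ∧ (n : ZMod 20) = 3) ∧ n ≠ 3) with hsdef
  have hs : ∀ p ∈ s, p.Prime := fun p hp ↦ (Finset.mem_filter.mp hp).2.1.1
  have hsum : ∑ n ∈ u, g n ≤ ∑ p ∈ s, (1 : ℝ) / p + 1 := by
    have h1 : ∑ p ∈ s, (1 : ℝ) / p =
        ∑ n ∈ u, if (n.Prime ∧ (n : ZMod 20) = 3) ∧ n ≠ 3 then (1 : ℝ) / n else 0 := by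
      rw [hsdef, Finset.sum_filter]
    have h2 : ∑ n ∈ u, (if n = 3 then (1 : ℝ) else 0) ≤ 1 := by
      rw [Finset.sum_ite_eq']; split_ifs <;> norm_num
    have h3 : ∑ n ∈ u, g n ≤ ∑ n ∈ u,
        ((if (n.Prime ∧ (n : ZMod 20) = 3) ∧ n ≠ 3 then (1 : ℝ) / n else 0) +
          (if n = 3 then (1 : ℝ) else 0)) := by
      refine Finset.sum_le_sum fun n _ ↦ ?_
      by_cases hn : n = 3
      · subst hn
        simp only [hgdef]
        split_ifs <;> norm_num
        all_goals simp_all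
      · simp [hgdef, hn]
    rw [Finset.sum_add_distrib] at h3
    linarith
  refine ⟨∏ p ∈ s, p, Finset.prod_ne_zero_iff.mpr fun p hp ↦ (hs p hp).ne_zero, ?_, ?_⟩
  · intro p hp hd
    obtain ⟨r, hr, hpr⟩ := (hp.prime.dvd_finsetProd_iff _).mp hd
    have hpr' : p = r := (Nat.prime_dvd_prime_iff_eq hp (hs r hr)).mp hpr
    subst hpr'
    obtain ⟨_, ⟨_, h2⟩, h3⟩ := Finset.mem_filter.mp hr
    have h4 : p % 20 = 3 := by
      have : ((p : ℕ) : ZMod 20) = ((3 : ℕ) : ZMod 20) := by exact_mod_cast h2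
      exact (ZMod.natCast_eq_natCast_iff' _ _ _).mp this
    exact ⟨h4, by omega⟩
  · refine (aux_totient s hs).trans_lt ?_
    rw [← Real.lt_log_iff_exp_lt hε]
    linarith

lemma aux_card (N : ℕ) (hN : N ≠ 0)
    (hp : ∀ p : ℕ, p.Prime → p ∣ N → p % 20 = 3 ∧ 23 ≤ p) (X : ℕ) :
    {n : ℕ | n ≤ X ∧ n % 4 = 1 ∧
      ¬∃ x y : ℕ, 0 < x ∧ 0 < y ∧ n = 80 * x * y + 12 * x + 5}.ncard ≤
      N.totient * (X / N + 1) + 2 := by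
  have hsub : {n : ℕ | n ≤ X ∧ n % 4 = 1 ∧
      ¬∃ x y : ℕ, 0 < x ∧ 0 < y ∧ n = 80 * x * y + 12 * x + 5} ⊆
      ((((Finset.Ico 0 (0 + X)).filter (fun k ↦ N.Coprime k)).image (fun k ↦ 4 * k + 5) ∪
        {1, 5} : Finset ℕ) : Set ℕ) := by
    rintro n ⟨h1, h2, h3⟩
    by_cases h15 : n = 1 ∨ n = 5
    · rcases h15 with rfl | rfl <;> simp
    obtain ⟨k, hk⟩ : ∃ k, n = 4 * k + 5 := ⟨(n - 5) / 4, by omega⟩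
    simp only [Finset.coe_union, Set.mem_union, Finset.mem_coe, Finset.mem_image,
      Finset.mem_filter, Finset.mem_Ico]
    refine Or.inl ⟨k, ⟨⟨by omega, by omega⟩, ?_⟩, hk.symm⟩
    by_contra hcop
    obtain ⟨p, hpp, hpN, x, hx⟩ := Nat.Prime.not_coprime_iff_dvd.mp hcop
    obtain ⟨h4, h5⟩ := hp p hpp hpN
    obtain ⟨y, hy⟩ : ∃ y, p = 20 * y + 3 := ⟨p / 20, by omega⟩
    refine h3 ⟨x, y, ?_, by omega, ?_⟩
    · rcases x.eq_zero_or_pos with rfl | h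
      · omega
      · exact h
    · rw [hk, hx, hy]; ring
  refine (Set.ncard_le_ncard hsub (Finset.finite_toSet _)).trans ?_
  rw [Set.ncard_coe_finset]
  refine (Finset.card_union_le _ _).trans ?_
  exact Nat.add_le_add (Finset.card_image_le.trans (Nat.Ico_filter_coprime_le 0 X hN))
    Finset.card_le_two

/-- The set `S = {80xy + 12x + 5 : x, y ≥ 1}` has density one in the residue
class `1 mod 4`: the proportion of `n ≤ X` with `n ≡ 1 (mod 4)` and `n ∉ S`
tends to `0` as `X → ∞`. -/
theorem density_one_in_class_one_mod_four :
    Filter.Tendsto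
      (fun X : ℕ =>
        (({n : ℕ | n ≤ X ∧ n % 4 = 1 ∧
            ¬∃ x y : ℕ, 0 < x ∧ 0 < y ∧ n = 80 * x * y + 12 * x + 5}.ncard : ℝ)
          / (X : ℝ)))
      Filter.atTop (nhds 0) := by
  rw [Metric.tendsto_atTop]
  intro ε hε
  obtain ⟨N, hN, hp, hlt⟩ := aux_exists (ε / 2) (by linarith)
  obtain ⟨M, hM⟩ := exists_nat_gt ((N.totient + 2 : ℝ) / (ε / 2))
  refine ⟨M + 1, fun X hX ↦ ?_⟩
  have hcard := aux_card N hN hp X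
  set b := {n : ℕ | n ≤ X ∧ n % 4 = 1 ∧
    ¬∃ x y : ℕ, 0 < x ∧ 0 < y ∧ n = 80 * x * y + 12 * x + 5}.ncard
  have hXM : (M : ℝ) + 1 ≤ X := by exact_mod_cast hX
  have hM0 : (0 : ℝ) ≤ M := Nat.cast_nonneg M
  have hX0 : (0 : ℝ) < X := by linarith
  have hb : (b : ℝ) ≤ N.totient * (X / N + 1) + 2 := by
    have h1 : (b : ℝ) ≤ N.totient * (((X / N : ℕ) : ℝ) + 1) + 2 := by exact_mod_cast hcard
    have h2 : ((X / N : ℕ) : ℝ) ≤ (X : ℝ) / N := Nat.cast_div_le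
    have h3 : (N.totient : ℝ) * (((X / N : ℕ) : ℝ) + 1) ≤ N.totient * ((X : ℝ) / N + 1) := by
      gcongr
    linarith
  rw [Real.dist_eq, sub_zero, abs_of_nonneg (by positivity), div_lt_iff₀ hX0]
  rw [div_lt_iff₀ (by positivity)] at hM
  have h4 : (N.totient : ℝ) * (X / N + 1) = N.totient / N * X + N.totient := by ring
  have h5 : (N.totient : ℝ) / N * X ≤ ε / 2 * X := by gcongr
  have h6 : (M : ℝ) * (ε / 2) ≤ X * (ε / 2) := by gcongr; linarith
  rw [h4] at hb
  linarith
end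

section
/- For every positive integer q and every integer n with n ≡ 1 (mod 4), there exist positive integers x, y, z such that 64·x·y·z + 16·x·y + 4·x + 4·z + 1 ≡ n (mod q). That is, the admissible set of the ternary cubic F(x,y,z) = 64xyz + 16xy + 4x + 4z + 1 consists exactly of the integers congruent to 1 mod 4 (every value of F is ≡ 1 mod 4, and every such residue class mod q is attained). -/
/-- The admissible set of `F(x,y,z) = 64xyz + 16xy + 4x + 4z + 1` is exactly
the class `1 mod 4`: every value of `F` on positive integers is `≡ 1 (mod 4)`,
and for every modulus `q ≥ 1` and every integer `n ≡ 1 (mod 4)` the congruence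
`F(x,y,z) ≡ n (mod q)` is solvable in positive integers. -/
theorem admissible_set_of_ternary_cubic :
    (∀ x y z : ℕ, 0 < x → 0 < y → 0 < z →
      ((64 * x * y * z + 16 * x * y + 4 * x + 4 * z + 1 : ℤ) ≡ 1 [ZMOD (4 : ℤ)])) ∧
    (∀ q : ℕ, 0 < q → ∀ n : ℤ, n % 4 = 1 →
      ∃ x y z : ℕ, 0 < x ∧ 0 < y ∧ 0 < z ∧
        ((64 * x * y * z + 16 * x * y + 4 * x + 4 * z + 1 : ℤ) ≡ n [ZMOD (q : ℤ)])) := by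
  refine ⟨?_, ?_⟩
  · intro x y z _ _ _
    refine (Int.modEq_iff_dvd.mpr ⟨-(16 * x * y * z + 4 * x * y + x + z), ?_⟩)
    ring
  · intro q hq n hn
    obtain ⟨m, rfl⟩ : ∃ m : ℤ, n = 4 * m + 1 := ⟨n / 4, by omega⟩
    have hq' : (0 : ℤ) < q := by exact_mod_cast hq
    have hr := Int.emod_nonneg m hq'.ne'
    have hd := Int.emod_add_mul_ediv m q
    obtain ⟨z, hz⟩ := Int.eq_ofNat_of_zero_le (show (0 : ℤ) ≤ m % q + q by omega)
    refine ⟨q, q, z, hq, hq, by omega, ?_⟩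
    refine Int.modEq_iff_dvd.mpr
      ⟨4 * (m / q) - 4 - (64 * q * z + 16 * q + 4), ?_⟩
    linear_combination (-4 : ℤ) * hd + 4 * hz
end

section
/- There exists a constant c > 0 such that for all real X ≥ 2, the number of positive integers n ≤ X that are NOT expressible as n = x·y·z + x + y + z with positive integers x, y, z is at most c·X/(log X)². -/
namespace UnrepSieve
open Finset BoundingSieve ArithmeticFunction
open scoped ArithmeticFunction.Moebius

lemma sum_moebius_div (m : ℕ) :
    ∑ e ∈ m.divisors, ((μ e : ℤ) : ℝ) = if m = 1 then 1 else 0 := by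
  have h := congrArg (fun f : ArithmeticFunction ℝ => f m) (coe_moebius_mul_coe_zeta (R := ℝ))
  simp only [coe_mul_zeta_apply, one_apply] at h
  simpa using h

lemma moebius_between {P k l : ℕ} (hP : Squarefree P) (hl : l ∣ P) :
    ∑ d ∈ P.divisors with k ∣ d ∧ d ∣ l, ((μ d : ℤ) : ℝ) = if k = l then ((μ k : ℤ) : ℝ) else 0 := by
  have hP0 : P ≠ 0 := hP.ne_zero
  have hl0 : l ≠ 0 := ne_zero_of_dvd_ne_zero hP0 hl
  by_cases hkl : k ∣ l
  · obtain ⟨m, rfl⟩ := hkl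
    have hk0 : k ≠ 0 := left_ne_zero_of_mul hl0
    have hm0 : m ≠ 0 := right_ne_zero_of_mul hl0
    have hsq : Squarefree (k * m) := hP.squarefree_of_dvd hl
    have hset : (P.divisors.filter fun d => k ∣ d ∧ d ∣ k * m) = m.divisors.image (k * ·) := by
      ext d
      simp only [mem_filter, Nat.mem_divisors, mem_image]
      constructor
      · rintro ⟨_, ⟨e, rfl⟩, h⟩
        exact ⟨e, ⟨Nat.dvd_of_mul_dvd_mul_left (Nat.pos_of_ne_zero hk0) h, hm0⟩, rfl⟩
      · rintro ⟨e, ⟨he, _⟩, rfl⟩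
        have : k * e ∣ k * m := Nat.mul_dvd_mul_left k he
        exact ⟨⟨this.trans hl, hP0⟩, ⟨e, rfl⟩, this⟩
    rw [hset, sum_image (by
      intro a _ b _ h
      exact Nat.eq_of_mul_eq_mul_left (Nat.pos_of_ne_zero hk0) h)]
    have : ∀ e ∈ m.divisors, ((μ (k * e) : ℤ) : ℝ) = (μ k : ℤ) * ((μ e : ℤ) : ℝ) := by
      intro e he
      have hc : Nat.Coprime k e := Nat.coprime_of_squarefree_mul
        (hsq.squarefree_of_dvd (Nat.mul_dvd_mul_left k (Nat.dvd_of_mem_divisors he)))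
      rw [isMultiplicative_moebius.map_mul_of_coprime hc]; push_cast; rfl
    rw [sum_congr rfl this, ← mul_sum, sum_moebius_div m]
    by_cases hm1 : m = 1
    · simp [hm1]
    · have : k ≠ k * m := by
        intro h
        apply hm1
        exact (Nat.eq_of_mul_eq_mul_left (Nat.pos_of_ne_zero hk0) (by simpa using h)).symm
      simp [hm1, this]
  · have : k ≠ l := fun h => hkl (h ▸ dvd_rfl)
    rw [if_neg this]
    apply sum_eq_zero
    intro d hd
    simp only [mem_filter] at hd
    exact absurd (hd.2.1.trans hd.2.2) hkl

variable (s : BoundingSieve) (D : ℕ)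

/-- The set of divisors of the sieving product up to the level. -/
noncomputable def LL : Finset ℕ := s.prodPrimes.divisors.filter (· ≤ D)

/-- The Selberg sum. -/
noncomputable def SS : ℝ := ∑ l ∈ LL s D, s.selbergTerms l

/-- The Selberg weights. -/
noncomputable def ww (d : ℕ) : ℝ :=
  (s.nu d)⁻¹ * (μ d : ℤ) * ((SS s D)⁻¹ * ∑ l ∈ LL s D with d ∣ l, s.selbergTerms l)

lemma SS_pos (hD : 1 ≤ D) : 0 < SS s D := by
  apply sum_pos
  · intro l hl
    exact selbergTerms_pos (Nat.dvd_of_mem_divisors (mem_filter.1 hl).1)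
  · exact ⟨1, by simp [LL, hD, s.prodPrimes_squarefree.ne_zero]⟩

lemma ww_one (hD : 1 ≤ D) : ww s D 1 = 1 := by
  have := (SS_pos s D hD).ne'
  simp only [ww, s.nu_mult.map_one, moebius_apply_one, one_dvd, filter_true]
  change (1:ℝ)⁻¹ * ((1:ℤ):ℝ) * ((SS s D)⁻¹ * SS s D) = 1
  field_simp; simp

lemma sum_part_nonneg (d : ℕ) : 0 ≤ ∑ l ∈ LL s D with d ∣ l, s.selbergTerms l := by
  apply sum_nonneg
  intro l hl
  exact (selbergTerms_pos (Nat.dvd_of_mem_divisors (mem_filter.1 (mem_filter.1 hl).1).1)).le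

lemma abs_ww_le (hD : 1 ≤ D) {d : ℕ} (hd : d ∣ s.prodPrimes) : |ww s D d| ≤ (s.nu d)⁻¹ := by
  have hS := SS_pos s D hD
  have hn := nu_pos_of_dvd_prodPrimes hd
  have h1 : |((μ d : ℤ) : ℝ)| ≤ 1 := by
    exact_mod_cast abs_moebius_le_one (n := d)
  have h2 : (∑ l ∈ LL s D with d ∣ l, s.selbergTerms l) ≤ SS s D := by
    apply sum_le_sum_of_subset_of_nonneg (filter_subset _ _)
    intro l hl _
    exact (selbergTerms_pos (Nat.dvd_of_mem_divisors (mem_filter.1 hl).1)).le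
  have h3 : (SS s D)⁻¹ * (∑ l ∈ LL s D with d ∣ l, s.selbergTerms l) ≤ 1 := by
    rw [inv_mul_le_one₀ hS]; exact h2
  have h4 := sum_part_nonneg s D d
  have h5 : 0 ≤ (SS s D)⁻¹ * (∑ l ∈ LL s D with d ∣ l, s.selbergTerms l) := by positivity
  rw [ww, abs_mul, abs_mul, abs_of_pos (inv_pos.2 hn), abs_of_nonneg h5]
  have : |((μ d : ℤ) : ℝ)| * ((SS s D)⁻¹ * (∑ l ∈ LL s D with d ∣ l, s.selbergTerms l)) ≤ 1 :=
    mul_le_one₀ h1 h5 h3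
  rw [mul_assoc]
  exact mul_le_of_le_one_right (inv_pos.2 hn).le this

lemma ww_zero {d : ℕ} (hd : D < d) : ww s D d = 0 := by
  have : (LL s D).filter (d ∣ ·) = ∅ := by
    apply filter_eq_empty_iff.2
    intro l hl h
    simp only [LL, mem_filter, Nat.mem_divisors] at hl
    have := Nat.le_of_dvd (Nat.pos_of_ne_zero (ne_zero_of_dvd_ne_zero hl.1.2 hl.1.1)) h
    omega
  simp [ww, this]

lemma inner_sum {k : ℕ} :
    (∑ d ∈ s.prodPrimes.divisors, if k ∣ d then s.nu d * ww s D d else 0) =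
      if k ∈ LL s D then (SS s D)⁻¹ * (s.selbergTerms k * (μ k : ℤ)) else 0 := by
  have h1 : ∀ d ∈ s.prodPrimes.divisors, (if k ∣ d then s.nu d * ww s D d else 0) =
      ∑ l ∈ LL s D, (SS s D)⁻¹ * (s.selbergTerms l *
        (if k ∣ d ∧ d ∣ l then ((μ d : ℤ) : ℝ) else 0)) := by
    intro d hd
    have hn := (nu_pos_of_dvd_prodPrimes (Nat.dvd_of_mem_divisors hd)).ne'
    by_cases hk : k ∣ d
    · simp only [hk, if_true, true_and, ww]
      rw [← mul_sum]
      have : s.nu d * ((s.nu d)⁻¹ * ((μ d : ℤ) : ℝ) *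
        ((SS s D)⁻¹ * ∑ l ∈ LL s D with d ∣ l, s.selbergTerms l)) =
        (SS s D)⁻¹ * (((μ d : ℤ) : ℝ) * ∑ l ∈ LL s D with d ∣ l, s.selbergTerms l) := by
        field_simp
      rw [this, sum_filter, mul_sum]
      congr 1
      apply sum_congr rfl
      intro l _
      split_ifs <;> ring
    · simp [hk]
  rw [sum_congr rfl h1, sum_comm]
  have h2 : ∀ l ∈ LL s D, (∑ d ∈ s.prodPrimes.divisors, (SS s D)⁻¹ * (s.selbergTerms l *
        (if k ∣ d ∧ d ∣ l then ((μ d : ℤ) : ℝ) else 0))) =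
        if k = l then (SS s D)⁻¹ * (s.selbergTerms k * (μ k : ℤ)) else 0 := by
    intro l hl
    rw [← mul_sum, ← mul_sum, ← sum_filter,
      moebius_between s.prodPrimes_squarefree (Nat.dvd_of_mem_divisors (mem_filter.1 hl).1)]
    split_ifs with h
    · rw [h]
    · simp
  rw [sum_congr rfl h2, sum_ite_eq]

lemma mainSum_ww (hD : 1 ≤ D) : s.mainSum (lambdaSquared (ww s D)) = (SS s D)⁻¹ := by
  have hS := (SS_pos s D hD).ne'
  rw [mainSum_lambdaSquared_eq_sum_mul_sum_sq]
  simp_rw [inner_sum]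
  have h1 : ∀ l ∈ s.prodPrimes.divisors, (s.selbergTerms l)⁻¹ *
      (if l ∈ LL s D then (SS s D)⁻¹ * (s.selbergTerms l * (μ l : ℤ)) else 0) ^ 2 =
      if l ≤ D then (SS s D)⁻¹ ^ 2 * s.selbergTerms l else 0 := by
    intro l hl
    have hg := (selbergTerms_pos (Nat.dvd_of_mem_divisors hl)).ne'
    have hmu : ((μ l : ℤ) : ℝ) ^ 2 = 1 := by
      exact_mod_cast moebius_sq_eq_one_of_squarefree (squarefree_of_mem_divisors_prodPrimes hl)
    have : l ∈ LL s D ↔ l ≤ D := by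
      rw [LL, mem_filter]; exact ⟨fun h => h.2, fun h => ⟨hl, h⟩⟩
    simp only [this]
    split_ifs
    · rw [mul_pow, mul_pow, hmu]; field_simp
    · simp
  rw [sum_congr rfl h1, ← sum_filter, ← mul_sum]
  change (SS s D)⁻¹ ^ 2 * SS s D = _
  field_simp

lemma errSum_ww (hD : 1 ≤ D) (hnu : ∀ d, d ∣ s.prodPrimes → (s.nu d)⁻¹ ≤ d)
    (hrem : ∀ d, d ∣ s.prodPrimes → |s.rem d| ≤ d) :
    s.errSum (lambdaSquared (ww s D)) ≤ (D : ℝ) ^ 6 := by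
  set w := ww s D with hw
  have hP0 := s.prodPrimes_squarefree.ne_zero
  have h1 : ∀ d ∈ s.prodPrimes.divisors, |lambdaSquared w d| * |s.rem d| ≤
      ∑ d1 ∈ s.prodPrimes.divisors, ∑ d2 ∈ s.prodPrimes.divisors,
        if d = Nat.lcm d1 d2 then (|w d1| * d1) * (|w d2| * d2) else 0 := by
    intro d hd
    have hdP := Nat.dvd_of_mem_divisors hd
    calc |lambdaSquared w d| * |s.rem d| ≤
        (∑ d1 ∈ d.divisors, ∑ d2 ∈ d.divisors,
          if d = Nat.lcm d1 d2 then |w d1| * |w d2| else 0) * d := by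
          apply mul_le_mul _ (hrem d hdP) (abs_nonneg _)
          · apply sum_nonneg; intros; apply sum_nonneg; intros; split_ifs <;> positivity
          · unfold lambdaSquared
            refine (abs_sum_le_sum_abs _ _).trans (sum_le_sum fun d1 _ => ?_)
            refine (abs_sum_le_sum_abs _ _).trans (sum_le_sum fun d2 _ => ?_)
            split_ifs
            · rw [abs_mul]
            · simp
      _ ≤ (∑ d1 ∈ s.prodPrimes.divisors, ∑ d2 ∈ s.prodPrimes.divisors,
          if d = Nat.lcm d1 d2 then |w d1| * |w d2| else 0) * d := by
          apply mul_le_mul_of_nonneg_right _ (Nat.cast_nonneg d)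
          have hsub := Nat.divisors_subset_of_dvd hP0 hdP
          refine (sum_le_sum fun d1 _ => ?_).trans (sum_le_sum_of_subset_of_nonneg hsub ?_)
          · apply sum_le_sum_of_subset_of_nonneg hsub
            intros; split_ifs <;> positivity
          · intros; apply sum_nonneg; intros; split_ifs <;> positivity
      _ ≤ _ := by
          rw [sum_mul]
          refine sum_le_sum fun d1 h1 => ?_
          rw [sum_mul]
          refine sum_le_sum fun d2 h2 => ?_
          split_ifs with h
          · have hle : (d : ℝ) ≤ d1 * d2 := by
              have h10 := ne_zero_of_dvd_ne_zero hP0 (Nat.dvd_of_mem_divisors h1)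
              have h20 := ne_zero_of_dvd_ne_zero hP0 (Nat.dvd_of_mem_divisors h2)
              have : d ≤ d1 * d2 := by
                rw [h]
                exact Nat.le_of_dvd (by positivity) (Nat.lcm_dvd_mul d1 d2)
              exact_mod_cast this
            calc |w d1| * |w d2| * d ≤ |w d1| * |w d2| * (d1 * d2) := by gcongr
              _ = _ := by ring
          · simp
  have h2 : s.errSum (lambdaSquared w) ≤
      (∑ d1 ∈ s.prodPrimes.divisors, |w d1| * d1) ^ 2 := by
    unfold errSum
    refine (sum_le_sum h1).trans ?_
    rw [sum_comm, sq, sum_mul]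
    refine sum_le_sum fun d1 h1 => ?_
    rw [sum_comm, mul_sum]
    refine sum_le_sum fun d2 h2 => ?_
    rw [sum_ite_eq']
    split_ifs
    · exact le_rfl
    · positivity
  refine h2.trans ?_
  have h3 : (∑ d1 ∈ s.prodPrimes.divisors, |w d1| * d1) ≤ (D : ℝ) ^ 3 := by
    have h4 : (∑ d1 ∈ s.prodPrimes.divisors, |w d1| * d1) ≤
        ∑ d1 ∈ s.prodPrimes.divisors, if d1 ≤ D then (D : ℝ) ^ 2 else 0 := by
      refine sum_le_sum fun d hd => ?_
      split_ifs with h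
      · have hdP := Nat.dvd_of_mem_divisors hd
        have ha := (abs_ww_le s D hD hdP).trans (hnu d hdP)
        have hb : (d : ℝ) ≤ D := by exact_mod_cast h
        rw [sq]
        exact mul_le_mul (ha.trans hb) hb (by positivity) (by positivity)
      · rw [hw, ww_zero s D (by omega)]; simp
    refine h4.trans ?_
    rw [← sum_filter, sum_const, nsmul_eq_mul]
    have h5 : ((s.prodPrimes.divisors.filter (· ≤ D)).card : ℝ) ≤ D := by
      have : (s.prodPrimes.divisors.filter (· ≤ D)) ⊆ Icc 1 D := by
        intro x hx
        simp only [mem_filter, Nat.mem_divisors] at hx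
        exact mem_Icc.2 ⟨Nat.pos_of_ne_zero (ne_zero_of_dvd_ne_zero hx.1.2 hx.1.1), hx.2⟩
      have := card_le_card this
      simp only [Nat.card_Icc, Nat.add_sub_cancel] at this
      exact_mod_cast this
    calc _ ≤ (D : ℝ) * D ^ 2 := by gcongr
      _ = _ := by ring
  have h0 : 0 ≤ ∑ d1 ∈ s.prodPrimes.divisors, |w d1| * d1 := by
    apply sum_nonneg; intros; positivity
  calc _ ≤ ((D : ℝ) ^ 3) ^ 2 := by gcongr
    _ = _ := by ring

theorem selberg_bound (hD : 1 ≤ D) (hnu : ∀ d, d ∣ s.prodPrimes → (s.nu d)⁻¹ ≤ d)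
    (hrem : ∀ d, d ∣ s.prodPrimes → |s.rem d| ≤ d) :
    s.siftedSum ≤ s.totalMass / SS s D + (D : ℝ) ^ 6 := by
  have h := siftedSum_le_mainSum_errSum_of_upperMoebius (s := s) _
    (upperMoebius_lambdaSquared _ (ww_one s D hD))
  rw [mainSum_ww s D hD] at h
  have := errSum_ww s D hD hnu hrem
  rw [div_eq_mul_inv]
  linarith

end UnrepSieve
namespace UnrepSieve
open Finset ArithmeticFunction

/-- The sieved polynomial, `n (2n - 3)` at `n = m + 2`. -/
def ff (m : ℕ) : ℕ := (m + 2) * (2 * m + 1)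

/-- Number of roots modulo `d`. -/
def rho (d : ℕ) : ℕ := #{a ∈ range d | d ∣ ff a}

lemma ff_modEq {d a b : ℕ} (h : a ≡ b [MOD d]) : ff a ≡ ff b [MOD d] :=
  (h.add_right 2).mul ((h.mul_left 2).add_right 1)

lemma dvd_ff_iff {d a b : ℕ} (h : a ≡ b [MOD d]) : d ∣ ff a ↔ d ∣ ff b :=
  (ff_modEq h).dvd_iff dvd_rfl

lemma rho_mul {m n : ℕ} (hm : 0 < m) (hn : 0 < n) (h : m.Coprime n) :
    rho (m * n) = rho m * rho n := by
  unfold rho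
  rw [← card_product]
  apply card_bij (fun a _ => (a % m, a % n))
  · intro a ha
    simp only [mem_filter, mem_range, mem_product] at ha ⊢
    refine ⟨⟨Nat.mod_lt _ hm, ?_⟩, Nat.mod_lt _ hn, ?_⟩
    · exact (dvd_ff_iff (Nat.mod_modEq a m)).2 ((Dvd.intro _ rfl).trans ha.2)
    · exact (dvd_ff_iff (Nat.mod_modEq a n)).2 ((Dvd.intro_left _ rfl).trans ha.2)
  · intro a ha b hb hab
    simp only [mem_filter, mem_range, Prod.mk.injEq] at ha hb hab
    have : a ≡ b [MOD m * n] := (Nat.modEq_and_modEq_iff_modEq_mul h).1 ⟨hab.1, hab.2⟩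
    exact Nat.ModEq.eq_of_lt_of_lt this ha.1 hb.1
  · rintro ⟨x, y⟩ hxy
    simp only [mem_filter, mem_range, mem_product] at hxy
    obtain ⟨⟨hx, hx'⟩, hy, hy'⟩ := hxy
    let c := Nat.chineseRemainder h x y
    have hc : (c : ℕ) < m * n := Nat.chineseRemainder_lt_mul h x y hm.ne' hn.ne'
    refine ⟨c, ?_, ?_⟩
    · simp only [mem_filter, mem_range]
      refine ⟨hc, h.mul_dvd_of_dvd_of_dvd ((dvd_ff_iff c.2.1).2 hx') ((dvd_ff_iff c.2.2).2 hy')⟩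
    · have h1 : (c : ℕ) % m = x % m := c.2.1
      have h2 : (c : ℕ) % n = y % n := c.2.2
      rw [h1, h2, Nat.mod_eq_of_lt hx, Nat.mod_eq_of_lt hy]

lemma rho_prime {p : ℕ} (hp : p.Prime) (h5 : 5 ≤ p) : rho p = 2 := by
  have hodd : p % 2 = 1 := by
    rcases hp.eq_two_or_odd with h | h <;> omega
  have : {a ∈ range p | p ∣ ff a} = {p - 2, (p - 1) / 2} := by
    ext a
    simp only [mem_filter, mem_range, mem_insert, mem_singleton, ff, hp.dvd_mul]
    constructor
    · rintro ⟨ha, ⟨k, hk⟩ | ⟨k, hk⟩⟩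
      · left
        have : k = 1 := by
          rcases k with _ | _ | k
          · omega
          · rfl
          · nlinarith
        subst this; omega
      · right
        have : k = 1 := by
          rcases k with _ | _ | k
          · omega
          · rfl
          · nlinarith
        subst this; omega
    · rintro (rfl | rfl)
      · exact ⟨by omega, Or.inl ⟨1, by omega⟩⟩
      · exact ⟨by omega, Or.inr ⟨1, by omega⟩⟩
  rw [rho, this, card_pair (by omega)]

/-- The density function. -/
noncomputable def nuF : ArithmeticFunction ℝ := ⟨fun d => (rho d : ℝ) / d, by simp⟩

lemma nuF_apply (d : ℕ) : nuF d = (rho d : ℝ) / d := rfl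

lemma nuF_mult : nuF.IsMultiplicative := by
  rw [IsMultiplicative.iff_ne_zero]
  constructor
  · simp [nuF_apply, rho]
  · intro m n hm hn h
    simp only [nuF_apply, rho_mul (Nat.pos_of_ne_zero hm) (Nat.pos_of_ne_zero hn) h]
    push_cast
    rw [mul_div_mul_comm]

lemma count_bound (N d : ℕ) (hd : 0 < d) :
    |(#{m ∈ range N | d ∣ ff m} : ℝ) - (rho d : ℝ) / d * N| ≤ d := by
  have hper : ∀ q r, #{m ∈ range (d * q + r) | d ∣ ff m} =
      q * rho d + #{m ∈ range r | d ∣ ff m} := by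
    intro q r
    simp only [rho, ← Nat.count_eq_card_filter_range]
    induction q with
    | zero => simp
    | succ q ih =>
      have : d * (q + 1) + r = d + (d * q + r) := by ring
      rw [this, Nat.count_add]
      have h2 : (fun k => d ∣ ff (d + k)) = fun k => d ∣ ff k := by
        funext k
        exact propext (dvd_ff_iff (by simp [Nat.ModEq]))
      simp only [h2, ih]; ring
  have h := hper (N / d) (N % d)
  rw [Nat.div_add_mod] at h
  have hr : #{m ∈ range (N % d) | d ∣ ff m} ≤ N % d := by
    simpa using card_filter_le (range (N % d)) (fun m => d ∣ ff m)
  have hrho : rho d ≤ d := by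
    simpa [rho] using card_filter_le (range d) (fun m => d ∣ ff m)
  have hlt := Nat.mod_lt N hd
  set c := #{m ∈ range (N % d) | d ∣ ff m}
  have hN : (N : ℝ) = d * (N / d : ℕ) + (N % d : ℕ) := by
    exact_mod_cast (Nat.div_add_mod N d).symm
  rw [h, hN]
  have hd' : (0 : ℝ) < d := by exact_mod_cast hd
  have e : ((N / d * rho d + c : ℕ) : ℝ) - (rho d : ℝ) / d * (d * (N / d : ℕ) + (N % d : ℕ)) =
      c - (rho d : ℝ) / d * (N % d : ℕ) := by
    push_cast; field_simp; ring
  rw [e]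
  have a1 : (c : ℝ) ≤ (N % d : ℕ) := by exact_mod_cast hr
  have a2 : ((N % d : ℕ) : ℝ) ≤ d := by exact_mod_cast hlt.le
  have a3 : (rho d : ℝ) / d ≤ 1 := by
    rw [div_le_one hd']; exact_mod_cast hrho
  have a4 : 0 ≤ (rho d : ℝ) / d := by positivity
  have a5 : (0 : ℝ) ≤ c := by positivity
  have a6 : (rho d : ℝ) / d * (N % d : ℕ) ≤ (N % d : ℕ) :=
    mul_le_of_le_one_left (by positivity) a3
  have a7 : 0 ≤ (rho d : ℝ) / d * (N % d : ℕ) := by positivity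
  rw [abs_le]; constructor <;> linarith

/-- The primes in `[5, D]`. -/
def prs (D : ℕ) : Finset ℕ := {p ∈ Icc 5 D | p.Prime}

lemma prs_sqf (D : ℕ) : Squarefree (∏ p ∈ prs D, p) := by
  apply Finset.squarefree_prod_of_pairwise_isCoprime
  · intro a ha b hb hab
    simp only [prs, coe_filter, Set.mem_ofPred_eq] at ha hb
    exact Nat.coprime_iff_isRelPrime.1 ((Nat.coprime_primes ha.2 hb.2).2 hab)
  · intro p hp
    exact (mem_filter.1 hp).2.prime.squarefree

lemma prime_dvd_prs {D p : ℕ} (hp : p.Prime) (h : p ∣ ∏ p ∈ prs D, p) : 5 ≤ p ∧ p ≤ D := by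
  obtain ⟨q, hq, hpq⟩ := (hp.prime.dvd_finsetProd_iff _).1 h
  simp only [prs, mem_filter, mem_Icc] at hq
  have := (Nat.prime_dvd_prime_iff_eq hp hq.2).1 hpq
  subst this; exact hq.1

lemma dvd_prs {D l : ℕ} (hl : Squarefree l) (h6 : l.Coprime 6) (hD : l ≤ D) :
    l ∣ ∏ p ∈ prs D, p := by
  rw [← Nat.prod_primeFactors_of_squarefree hl]
  apply prod_dvd_prod_of_subset
  intro p hp
  have hpp := Nat.prime_of_mem_primeFactors hp
  have hpl := Nat.dvd_of_mem_primeFactors hp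
  have hle := Nat.le_of_dvd (Nat.pos_of_ne_zero hl.ne_zero) hpl
  simp only [prs, mem_filter, mem_Icc]
  refine ⟨⟨?_, by omega⟩, hpp⟩
  by_contra hlt
  have hc : p.Coprime 6 := h6.coprime_dvd_left hpl
  have : p < 5 := by omega
  interval_cases p <;> revert hc hpp <;> decide

/-- The sieve. -/
noncomputable def sv (N D : ℕ) : BoundingSieve where
  support := (range N).image ff
  prodPrimes := ∏ p ∈ prs D, p
  prodPrimes_squarefree := prs_sqf D
  weights := fun _ => 1
  weights_nonneg := fun _ => zero_le_one
  totalMass := N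
  nu := nuF
  nu_mult := nuF_mult
  nu_pos_of_prime := by
    intro p hp h
    have := prime_dvd_prs hp h
    have h0 := hp.pos
    rw [nuF_apply, rho_prime hp this.1]; positivity
  nu_lt_one_of_prime := by
    intro p hp h
    have := prime_dvd_prs hp h
    rw [nuF_apply, rho_prime hp this.1, div_lt_one (by exact_mod_cast hp.pos)]
    have : 2 < p := by omega
    exact_mod_cast this

lemma ff_inj : Function.Injective ff := by
  have : StrictMono ff := by
    intro a b h
    unfold ff
    nlinarith
  exact this.injective

lemma sv_rem (N D d : ℕ) (hd : d ∣ (sv N D).prodPrimes) : |(sv N D).rem d| ≤ d := by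
  have hd0 : 0 < d := Nat.pos_of_ne_zero (ne_zero_of_dvd_ne_zero (prs_sqf D).ne_zero hd)
  have := count_bound N d hd0
  have e : (sv N D).multSum d = (#{m ∈ range N | d ∣ ff m} : ℝ) := by
    simp only [BoundingSieve.multSum, sv]
    rw [sum_image (ff_inj.injOn), ← sum_filter]
    simp
  rw [BoundingSieve.rem, e]
  exact this

lemma sv_nu (N D d : ℕ) (hd : d ∣ (sv N D).prodPrimes) : ((sv N D).nu d)⁻¹ ≤ d := by
  have h := BoundingSieve.nu_pos_of_dvd_prodPrimes hd
  change 0 < (rho d : ℝ) / d at h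
  change ((rho d : ℝ) / d)⁻¹ ≤ d
  have h1 : rho d ≠ 0 := by
    intro h0; simp [h0] at h
  have h2 : (1 : ℝ) ≤ rho d := by exact_mod_cast Nat.pos_of_ne_zero h1
  rw [inv_div]
  exact div_le_self (by positivity) h2

end UnrepSieve
namespace UnrepSieve
open Finset ArithmeticFunction

lemma nu_eq_tau {N D l : ℕ} (hl : l ∣ (sv N D).prodPrimes) :
    (sv N D).nu l = (#l.divisors : ℝ) / l := by
  have hsq := BoundingSieve.squarefree_of_dvd_prodPrimes hl
  rw [← BoundingSieve.prod_primeFactors_nu hl, Nat.card_divisors hsq.ne_zero]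
  conv_rhs => rw [← Nat.prod_primeFactors_of_squarefree hsq]
  rw [Nat.primeFactors_prod_primeFactors]
  push_cast
  rw [← prod_div_distrib]
  apply prod_congr rfl
  intro p hp
  have hpp := Nat.prime_of_mem_primeFactors hp
  have hpl := Nat.dvd_of_mem_primeFactors hp
  have h5 := prime_dvd_prs hpp (hpl.trans hl)
  have hf : (∏ p ∈ l.primeFactors, p).factorization p = 1 := by
    rw [Nat.prod_primeFactors_of_squarefree hsq]
    have a1 := hsq.natFactorization_le_one p
    have a2 := hpp.factorization_pos_of_dvd hsq.ne_zero hpl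
    omega
  change (rho p : ℝ) / p = _
  rw [rho_prime hpp h5.1, hf]; norm_num

lemma nu_le_selberg {s : BoundingSieve} {l : ℕ} (hl : l ∣ s.prodPrimes) :
    s.nu l ≤ s.selbergTerms l := by
  rw [BoundingSieve.selbergTerms_apply]
  apply le_mul_of_one_le_right (BoundingSieve.nu_pos_of_dvd_prodPrimes hl).le
  have key : ∀ p ∈ l.primeFactors, (1 : ℝ) ≤ (1 - s.nu p)⁻¹ := by
    intro p hp
    have hpp := Nat.prime_of_mem_primeFactors hp
    have hpl := (Nat.dvd_of_mem_primeFactors hp).trans hl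
    have h1 := s.nu_pos_of_prime p hpp hpl
    have h2 := s.nu_lt_one_of_prime p hpp hpl
    exact (one_le_inv₀ (by linarith)).2 (by linarith)
  simpa using prod_le_prod (s := l.primeFactors) (f := fun _ => (1 : ℝ))
      (fun _ _ => zero_le_one) key

/-- Pairs with product in the sieve support. -/
noncomputable def pairs (N D : ℕ) : Finset (ℕ × ℕ) :=
  {t ∈ Icc 1 D ×ˢ Icc 1 D | t.1 * t.2 ∈ LL (sv N D) D}

lemma pairs_sum_le (N D : ℕ) :
    ∑ t ∈ pairs N D, ((t.1 : ℝ) * t.2)⁻¹ ≤ SS (sv N D) D := by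
  rw [← sum_fiberwise_of_maps_to (s := pairs N D) (t := LL (sv N D) D) (g := fun t => t.1 * t.2)
    (fun t ht => (mem_filter.1 ht).2)]
  apply sum_le_sum
  intro l hl
  have hlP := Nat.dvd_of_mem_divisors (mem_filter.1 hl).1
  refine le_trans ?_ (nu_le_selberg hlP)
  rw [nu_eq_tau hlP]
  have hl0 : l ≠ 0 := (BoundingSieve.squarefree_of_dvd_prodPrimes hlP).ne_zero
  have h1 : ∑ t ∈ pairs N D with t.1 * t.2 = l, ((t.1 : ℝ) * t.2)⁻¹ =
      ∑ t ∈ pairs N D with t.1 * t.2 = l, (l : ℝ)⁻¹ := by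
    apply sum_congr rfl
    intro t ht
    rw [← (mem_filter.1 ht).2]; push_cast; rfl
  rw [h1, sum_const, nsmul_eq_mul, div_eq_mul_inv]
  gcongr
  refine (card_le_card_of_injOn (fun t => t.1) ?_ ?_)
  · intro t ht
    have := (mem_filter.1 (mem_coe.1 ht)).2
    exact mem_coe.2 (Nat.mem_divisors.2 ⟨⟨t.2, this.symm⟩, hl0⟩)
  · intro t ht t2 ht2 h
    have h1 := (mem_filter.1 (mem_coe.1 ht)).2
    have h2 := (mem_filter.1 (mem_coe.1 ht2)).2
    have h3 : t.1 = t2.1 := h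
    have h4 : 0 < t.1 := Nat.pos_of_ne_zero (by intro h0; simp [h0] at h1; omega)
    refine Prod.ext h3 (Nat.eq_of_mul_eq_mul_left h4 ?_)
    rw [h1, h3, h2]

/-- The parametrisation of pairs. -/
def par (q : (ℕ × ℕ × ℕ) × (ℕ × ℕ)) : ℕ × ℕ :=
  (q.1.2.2 * q.2.1 * q.1.1 ^ 2, q.1.2.2 * q.2.2 * q.1.2.1 ^ 2)

lemma sum_sq_le (D : ℕ) : ∑ u ∈ Icc 1 D, ((u : ℝ) ^ 2)⁻¹ ≤ 2 := by
  have := sum_Ioo_inv_sq_le (α := ℝ) 0 (D + 1)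
  have e : Ioo 0 (D + 1) = Icc 1 D := by ext x; simp only [mem_Ioo, mem_Icc]; omega
  rw [e] at this
  simpa using this

lemma decomp {M a b : ℕ} (N : ℕ) (ha : 0 < a) (hb : 0 < b) (haM : a ≤ M) (hbM : b ≤ M)
    (ha6 : a.Coprime 6) (hb6 : b.Coprime 6) :
    ∃ q ∈ (Icc 1 (M ^ 2) ×ˢ Icc 1 (M ^ 2) ×ˢ Icc 1 (M ^ 2)) ×ˢ pairs N (M ^ 2), par q = (a, b) := by
  obtain ⟨s1, u, rfl, hs1⟩ := Nat.sq_mul_squarefree a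
  obtain ⟨s2, v, rfl, hs2⟩ := Nat.sq_mul_squarefree b
  have hu : 0 < u := Nat.pos_of_ne_zero (by rintro rfl; simp at ha)
  have hv : 0 < v := Nat.pos_of_ne_zero (by rintro rfl; simp at hb)
  have hs1p : 0 < s1 := Nat.pos_of_ne_zero hs1.ne_zero
  have hs2p : 0 < s2 := Nat.pos_of_ne_zero hs2.ne_zero
  obtain ⟨e, t1, t2, he, hc, rfl, rfl⟩ := Nat.exists_coprime' (m := s1) (n := s2)
    (Nat.gcd_pos_of_pos_left _ hs1p)
  have ht1 : 0 < t1 := Nat.pos_of_mul_pos_right hs1p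
  have ht2 : 0 < t2 := Nat.pos_of_mul_pos_right hs2p
  have hM : M ≤ M ^ 2 := Nat.le_self_pow two_ne_zero M
  have q1 : t1 ≤ u ^ 2 * (t1 * e) :=
    Nat.le_of_dvd ha ((Dvd.intro _ rfl).trans (Dvd.intro_left _ rfl))
  have q2 : t2 ≤ v ^ 2 * (t2 * e) :=
    Nat.le_of_dvd hb ((Dvd.intro _ rfl).trans (Dvd.intro_left _ rfl))
  have q3 : e ≤ u ^ 2 * (t1 * e) :=
    Nat.le_of_dvd ha ((Dvd.intro_left _ rfl).trans (Dvd.intro_left _ rfl))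
  have q4 : u ≤ u ^ 2 * (t1 * e) :=
    Nat.le_of_dvd ha ((Dvd.intro_left _ (pow_succ u 1).symm).trans (Dvd.intro _ rfl))
  have q5 : v ≤ v ^ 2 * (t2 * e) :=
    Nat.le_of_dvd hb ((Dvd.intro_left _ (pow_succ v 1).symm).trans (Dvd.intro _ rfl))
  refine ⟨((u, v, e), (t1, t2)), ?_, ?_⟩
  · simp only [mem_product, mem_Icc, pairs, mem_filter, LL, Nat.mem_divisors]
    have hle : t1 * t2 ≤ M ^ 2 := by
      rw [sq]; exact Nat.mul_le_mul (q1.trans haM) (q2.trans hbM)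
    have hsq : Squarefree (t1 * t2) := (Nat.squarefree_mul hc).2
      ⟨hs1.squarefree_of_dvd (Dvd.intro _ rfl), hs2.squarefree_of_dvd (Dvd.intro _ rfl)⟩
    have h6 : (t1 * t2).Coprime 6 := by
      apply Nat.Coprime.mul_left
      · exact ha6.coprime_dvd_left ((Dvd.intro _ rfl).trans (Dvd.intro_left _ rfl))
      · exact hb6.coprime_dvd_left ((Dvd.intro _ rfl).trans (Dvd.intro_left _ rfl))
    have hdv := dvd_prs hsq h6 hle
    refine ⟨⟨⟨hu, by omega⟩, ⟨hv, by omega⟩, he, by omega⟩, ⟨⟨ht1, by omega⟩, ht2, by omega⟩,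
      ⟨hdv, (prs_sqf _).ne_zero⟩, hle⟩
  · simp only [par, Prod.mk.injEq]
    constructor <;> ring

lemma sum_T (I : Finset ℕ) (Q : Finset (ℕ × ℕ)) :
    ∑ q ∈ (I ×ˢ I ×ˢ I) ×ˢ Q, (((q.1.1 : ℝ) ^ 2)⁻¹ * (((q.1.2.1 : ℝ) ^ 2)⁻¹ *
      ((q.1.2.2 : ℝ) ^ 2)⁻¹)) * ((q.2.1 : ℝ) * q.2.2)⁻¹ =
      (∑ u ∈ I, ((u : ℝ) ^ 2)⁻¹) ^ 3 * ∑ t ∈ Q, ((t.1 : ℝ) * t.2)⁻¹ := by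
  rw [sum_product]
  dsimp only
  rw [← sum_mul_sum, sum_product]
  dsimp only
  rw [← sum_mul_sum, sum_product]
  dsimp only
  rw [← sum_mul_sum]
  ring

lemma SS_lower (N J : ℕ) :
    (Real.log (J + 1)) ^ 2 / 288 ≤ SS (sv N ((6 * J) ^ 2)) ((6 * J) ^ 2) := by
  set M := 6 * J with hMdef
  set I := Icc 1 (M ^ 2)
  set A := (range J).image (fun j => 6 * j + 1) with hA
  set T := (I ×ˢ I ×ˢ I) ×ˢ pairs N (M ^ 2) with hT
  have hsub : A ×ˢ A ⊆ T.image par := by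
    rintro ⟨a, b⟩ hab
    simp only [hA, mem_product, mem_image, mem_range] at hab
    obtain ⟨⟨i, hi, rfl⟩, j, hj, rfl⟩ := hab
    have hc : ∀ k, (6 * k + 1).Coprime 6 := by intro k; simp
    obtain ⟨q, hq, he⟩ := decomp (M := M) N (a := 6 * i + 1) (b := 6 * j + 1) (by omega) (by omega)
      (by omega) (by omega) (hc i) (hc j)
    exact mem_image.2 ⟨q, hq, he⟩
  have h1 : (∑ a ∈ A, (a : ℝ)⁻¹) ^ 2 ≤ ∑ q ∈ T, (((par q).1 : ℝ) * (par q).2)⁻¹ := by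
    have e : (∑ a ∈ A, (a : ℝ)⁻¹) ^ 2 = ∑ t ∈ A ×ˢ A, ((t.1 : ℝ) * t.2)⁻¹ := by
      rw [sq, sum_mul_sum, sum_product]
      simp_rw [mul_inv]
    rw [e]
    refine (sum_le_sum_of_subset_of_nonneg hsub (fun _ _ _ => by positivity)).trans ?_
    rw [← sum_fiberwise_of_maps_to (s := T) (t := T.image par) (g := par)
      (fun t ht => mem_image_of_mem _ ht)]
    apply sum_le_sum
    intro t ht
    obtain ⟨q, hq, rfl⟩ := mem_image.1 ht
    exact single_le_sum (s := T.filter (fun x => par x = par q))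
      (f := fun q => (((par q).1 : ℝ) * (par q).2)⁻¹) (fun _ _ => by positivity)
      (mem_filter.2 ⟨hq, rfl⟩)
  have h2 : ∑ q ∈ T, (((par q).1 : ℝ) * (par q).2)⁻¹ =
      (∑ u ∈ I, ((u : ℝ) ^ 2)⁻¹) ^ 3 * ∑ t ∈ pairs N (M ^ 2), ((t.1 : ℝ) * t.2)⁻¹ := by
    have e : ∀ q ∈ T, (((par q).1 : ℝ) * (par q).2)⁻¹ =
        (((q.1.1 : ℝ) ^ 2)⁻¹ * (((q.1.2.1 : ℝ) ^ 2)⁻¹ * ((q.1.2.2 : ℝ) ^ 2)⁻¹)) *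
          ((q.2.1 : ℝ) * q.2.2)⁻¹ := by
      intro q _
      simp only [par]; push_cast
      simp only [← mul_inv]
      congr 1; ring
    rw [sum_congr rfl e]
    exact sum_T I (pairs N (M ^ 2))
  have h3 := pairs_sum_le N (M ^ 2)
  have h4 : (∑ u ∈ I, ((u : ℝ) ^ 2)⁻¹) ^ 3 ≤ 2 ^ 3 := by
    have := sum_sq_le (M ^ 2)
    have h0 : 0 ≤ ∑ u ∈ I, ((u : ℝ) ^ 2)⁻¹ := sum_nonneg fun _ _ => by positivity
    gcongr
  have h5 : Real.log (J + 1) / 6 ≤ ∑ a ∈ A, (a : ℝ)⁻¹ := by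
    have hh := log_add_one_le_harmonic J
    push_cast at hh
    rw [hA, sum_image (by intro a _ b _ h; simpa using h)]
    have : (harmonic J : ℝ) / 6 ≤ ∑ j ∈ range J, ((6 * j + 1 : ℕ) : ℝ)⁻¹ := by
      clear hh
      simp only [harmonic]
      push_cast
      rw [sum_div]
      apply sum_le_sum
      intro j _
      rw [div_eq_mul_inv, ← mul_inv]
      apply inv_anti₀ (by positivity)
      linarith
    linarith
  have h6 : 0 ≤ Real.log (J + 1) := Real.log_nonneg (by linarith [Nat.cast_nonneg (α := ℝ) J])
  have h7 : (Real.log (J + 1) / 6) ^ 2 ≤ (∑ a ∈ A, (a : ℝ)⁻¹) ^ 2 := by gcongr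
  have h8 : 0 ≤ ∑ t ∈ pairs N (M ^ 2), ((t.1 : ℝ) * t.2)⁻¹ :=
    sum_nonneg fun t _ => inv_nonneg.2 (mul_nonneg (Nat.cast_nonneg _) (Nat.cast_nonneg _))
  have h9 := mul_le_mul_of_nonneg_right h4 h8
  have h10 : (Real.log (J + 1) / 6) ^ 2 ≤ 2 ^ 3 * SS (sv N (M ^ 2)) (M ^ 2) := by
    linarith
  have h11 : (Real.log (J + 1) / 6) ^ 2 = Real.log (J + 1) ^ 2 / 36 := by ring
  linarith

lemma unrep_prime {n : ℕ} (hn : 4 ≤ n) (h : ¬∃ x y z : ℕ, 0 < x ∧ 0 < y ∧ 0 < z ∧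
            n = x * y * z + x + y + z) : n.Prime ∧ (2 * n - 3).Prime := by
  constructor
  · by_contra hp
    obtain ⟨a, b, ha, hb, hab⟩ := (Nat.not_prime_iff_exists_mul_eq (by omega)).1 hp
    have ha2 : 2 ≤ a := by
      rcases a with _ | _ | a
      · omega
      · omega
      · omega
    have hb2 : 2 ≤ b := by
      rcases b with _ | _ | b
      · omega
      · omega
      · omega
    obtain ⟨x, rfl⟩ := Nat.exists_eq_add_of_le ha2
    obtain ⟨y, rfl⟩ := Nat.exists_eq_add_of_le hb2
    exact h ⟨x + 1, y + 1, 1, by omega, by omega, by omega, by rw [← hab]; ring⟩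
  · by_contra hp
    obtain ⟨a, b, ha, hb, hab⟩ := (Nat.not_prime_iff_exists_mul_eq (by omega)).1 hp
    have hodd : Odd (a * b) := ⟨n - 2, by omega⟩
    obtain ⟨⟨x, rfl⟩, ⟨y, rfl⟩⟩ := Nat.odd_mul.1 hodd
    have hx : 0 < x := Nat.pos_of_ne_zero (by rintro rfl; simp at hab hb; omega)
    have hy : 0 < y := Nat.pos_of_ne_zero (by rintro rfl; simp at hab ha; omega)
    refine h ⟨x, y, 2, hx, hy, by omega, ?_⟩
    have : (2 * x + 1) * (2 * y + 1) = 2 * (x * y * 2 + x + y) + 1 := by ring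
    omega

lemma sifted_count (N D : ℕ) :
    (#{m ∈ range N | D < m + 2 ∧ D < 2 * m + 1 ∧ (m + 2).Prime ∧ (2 * m + 1).Prime} : ℝ) ≤
      (sv N D).siftedSum := by
  have e : (sv N D).siftedSum = ∑ d ∈ (range N).image ff,
      if Nat.Coprime (∏ p ∈ prs D, p) d then (1 : ℝ) else 0 := rfl
  rw [e, sum_image ff_inj.injOn, ← sum_filter, sum_const, nsmul_eq_mul, mul_one]
  norm_cast
  apply card_le_card
  intro m hm
  simp only [mem_filter] at hm ⊢
  refine ⟨hm.1, ?_⟩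
  obtain ⟨_, h1, h2, h3, h4⟩ := hm
  apply Nat.coprime_of_dvd
  intro p hp hpP hpf
  have := prime_dvd_prs hp hpP
  rcases (hp.dvd_mul).1 hpf with h | h
  · have := (Nat.prime_dvd_prime_iff_eq hp h3).1 h
    omega
  · have := (Nat.prime_dvd_prime_iff_eq hp h4).1 h
    omega

lemma final_count (X : ℝ) (hX : 2 ≤ X) (D : ℕ) (hD : 1 ≤ D) :
    ({n : ℕ | 0 < n ∧ (n : ℝ) ≤ X ∧
          ¬∃ x y z : ℕ, 0 < x ∧ 0 < y ∧ 0 < z ∧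
            n = x * y * z + x + y + z}.ncard : ℝ) ≤
      (D + 4) + (X / SS (sv ⌊X⌋₊ D) D + (D : ℝ) ^ 6) := by
  set N := ⌊X⌋₊
  have hb := selberg_bound (sv N D) D hD (sv_nu N D) (sv_rem N D)
  have hs := sifted_count N D
  set F := {m ∈ range N | D < m + 2 ∧ D < 2 * m + 1 ∧ (m + 2).Prime ∧ (2 * m + 1).Prime}
  have hsub : {n : ℕ | 0 < n ∧ (n : ℝ) ≤ X ∧
          ¬∃ x y z : ℕ, 0 < x ∧ 0 < y ∧ 0 < z ∧
            n = x * y * z + x + y + z} ⊆ ((range (D + 4) ∪ F.image (· + 2) : Finset ℕ) : Set ℕ) := by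
    rintro n ⟨hn0, hnX, hn⟩
    simp only [coe_union, Set.mem_union, mem_coe, mem_range, mem_image]
    by_cases hlt : n < D + 4
    · exact Or.inl hlt
    · right
      have hp := unrep_prime (by omega) hn
      have hnN : n ≤ N := Nat.le_floor hnX
      obtain ⟨m, rfl⟩ := Nat.exists_eq_add_of_le (show 2 ≤ n by omega)
      refine ⟨m, ?_, by omega⟩
      simp only [F, mem_filter, mem_range]
      have e : 2 * (2 + m) - 3 = 2 * m + 1 := by omega
      rw [e] at hp
      refine ⟨by omega, by omega, by omega, ?_, hp.2⟩
      rw [add_comm]; exact hp.1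
  have h1 := Set.ncard_le_ncard hsub (finite_toSet _)
  rw [Set.ncard_coe_finset] at h1
  have h2 := h1.trans ((card_union_le _ _).trans (Nat.add_le_add_left card_image_le _))
  rw [card_range] at h2
  have h3 : ({n : ℕ | 0 < n ∧ (n : ℝ) ≤ X ∧
          ¬∃ x y z : ℕ, 0 < x ∧ 0 < y ∧ 0 < z ∧
            n = x * y * z + x + y + z}.ncard : ℝ) ≤ (D + 4) + (#F : ℝ) := by exact_mod_cast h2
  have h4 : (sv N D).totalMass / SS (sv N D) D ≤ X / SS (sv N D) D := by
    have hNX : ((N : ℕ) : ℝ) ≤ X := Nat.floor_le (by linarith)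
    have := SS_pos (sv N D) D hD
    change (N : ℝ) / _ ≤ _
    gcongr
  linarith

end UnrepSieve

/-- The number of positive integers `n ≤ X` not expressible as
`n = xyz + x + y + z` with positive integers `x, y, z` is `≤ c·X/(log X)²`. -/
theorem unrepresented_bound_log_squared :
    ∃ c : ℝ, 0 < c ∧ ∀ X : ℝ, 2 ≤ X →
      ({n : ℕ | 0 < n ∧ (n : ℝ) ≤ X ∧
          ¬∃ x y z : ℕ, 0 < x ∧ 0 < y ∧ 0 < z ∧
            n = x * y * z + x + y + z}.ncard : ℝ)
        ≤ c * X / Real.log X ^ 2 := by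
  refine ⟨288 * 256 + 6 * 6 ^ 12 * 64, by norm_num, fun X hX => ?_⟩
  have hX0 : 0 < X := by linarith
  set Y : ℝ := X ^ ((1 : ℝ) / 16) with hY
  have hY1 : 1 ≤ Y := Real.one_le_rpow (by linarith) (by norm_num)
  have hYX : Y ^ 16 = X := by
    rw [hY, ← Real.rpow_natCast, ← Real.rpow_mul hX0.le]; norm_num
  set J := ⌊Y⌋₊ with hJ
  have hJ1 : 1 ≤ J := Nat.le_floor (by simpa using hY1)
  have hJY : (J : ℝ) ≤ Y := Nat.floor_le (by linarith)
  have hYJ : Y ≤ J + 1 := (Nat.lt_floor_add_one Y).le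
  have hlogX : 0 < Real.log X := Real.log_pos (by linarith)
  have hlogY : Real.log X = 16 * Real.log Y := by
    rw [← hYX, Real.log_pow]; norm_num
  have hlogY0 : 0 < Real.log Y := by linarith
  set D := (6 * J) ^ 2 with hD
  have hD1 : 1 ≤ D := Nat.one_le_pow _ _ (by omega)
  have hc := UnrepSieve.final_count X hX D hD1
  have hS := UnrepSieve.SS_lower ⌊X⌋₊ J
  rw [← hD] at hS
  have hlogJ : Real.log Y ≤ Real.log (J + 1) := Real.log_le_log (by linarith) hYJ
  have hS2 : Real.log X ^ 2 / (288 * 256) ≤ UnrepSieve.SS (UnrepSieve.sv ⌊X⌋₊ D) D := by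
    have : Real.log Y ^ 2 ≤ Real.log (J + 1) ^ 2 := by gcongr
    rw [hlogY]; nlinarith
  have t1 : X / UnrepSieve.SS (UnrepSieve.sv ⌊X⌋₊ D) D ≤ 288 * 256 * (X / Real.log X ^ 2) := by
    calc _ ≤ X / (Real.log X ^ 2 / (288 * 256)) := by gcongr
      _ = _ := by field_simp
  have hDr : (1 : ℝ) ≤ D := by exact_mod_cast hD1
  have hD6 : (D : ℝ) ≤ (D : ℝ) ^ 6 := le_self_pow₀ hDr (by norm_num)
  have t2 : (D : ℝ) ^ 6 ≤ 6 ^ 12 * Y ^ 12 := by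
    have : (D : ℝ) ^ 6 = 6 ^ 12 * (J : ℝ) ^ 12 := by rw [hD]; push_cast; ring
    rw [this]; gcongr
  have t3 : Real.log X ^ 2 ≤ 64 * Y ^ 4 := by
    have h := Real.log_le_rpow_div hX0.le (show (0 : ℝ) < 1 / 8 by norm_num)
    have e : X ^ ((1 : ℝ) / 8) = Y ^ 2 := by
      rw [hY, ← Real.rpow_natCast, ← Real.rpow_mul hX0.le]; norm_num
    rw [e] at h
    have h' : Real.log X ≤ 8 * Y ^ 2 := by linarith
    calc Real.log X ^ 2 ≤ (8 * Y ^ 2) ^ 2 := by gcongr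
      _ = _ := by ring
  have t4 : Y ^ 12 ≤ 64 * (X / Real.log X ^ 2) := by
    rw [← mul_div_assoc, le_div_iff₀ (by positivity), ← hYX]
    calc Y ^ 12 * Real.log (Y ^ 16) ^ 2 ≤ Y ^ 12 * (64 * Y ^ 4) := by rw [hYX]; gcongr
      _ = _ := by ring
  have e : (288 * 256 + 6 * 6 ^ 12 * 64) * X / Real.log X ^ 2 =
      (288 * 256 + 6 * 6 ^ 12 * 64) * (X / Real.log X ^ 2) := by ring
  rw [e]
  linarith
end
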